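/- Fix an integer p ≥ 1 and t ∈ (0,1). Let u, v ∈ ℝ^p with 0 < u_i < v_i for all i. Then the probability, under the uniform distribution on (p,2n)-watermelons with wall condition, of the event { u_i·√(2n) ≤ W_i(⌊2nt⌋) ≤ v_i·√(2n) for all i = 1,…,p } converges, as n → ∞, to ∫_{[u_1,v_1]×⋯×[u_p,v_p]} f(t;x) dx. -/

import Mathlib

open MeasureTheory Filter

/-- A star of length `m` with wall condition, with `p` branches, encoded as a
function `Fin p → ℕ → ℤ` (values beyond time `m` are pinned to `0` so that the
collection of stars is a finite set). Branch `i` (0-indexed) starts at `2i`. -/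
def IsStarW (p m : ℕ) (w : Fin p → ℕ → ℤ) : Prop :=
  (∀ i : Fin p, w i 0 = 2 * ((i : ℕ) : ℤ)) ∧
  (∀ i : Fin p, ∀ k, k < m → (w i (k + 1) - w i k = 1 ∨ w i (k + 1) - w i k = -1)) ∧
  (∀ i : Fin p, ∀ k, k ≤ m → 0 ≤ w i k) ∧
  (∀ i j : Fin p, i < j → ∀ k, k ≤ m → w i k < w j k) ∧
  (∀ i : Fin p, ∀ k, m < k → w i k = 0)

/-- A `(p,2n)`-watermelon with wall condition. -/
def IsMelonW (p n : ℕ) (w : Fin p → ℕ → ℤ) : Prop :=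
  IsStarW p (2 * n) w ∧ ∀ i : Fin p, w i (2 * n) = 2 * ((i : ℕ) : ℤ)

/-- Probability of the event `E` under the uniform distribution on
`(p,2n)`-watermelons with wall condition. -/
noncomputable def probW (p n : ℕ) (E : (Fin p → ℕ → ℤ) → Prop) : ℝ :=
  (Nat.card {w : Fin p → ℕ → ℤ // IsMelonW p n w ∧ E w} : ℝ) /
    (Nat.card {w : Fin p → ℕ → ℤ // IsMelonW p n w} : ℝ)

/-- The normalizing constant `c_p` (indices `i < j` here are 0-indexed, so the
paper's `(j−i)(j+i−1)` becomes `(j−i)(j+i+1)`). -/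
noncomputable def cW (p : ℕ) : ℝ :=
  2 ^ ((3 * (p : ℝ)) / 2) * (Nat.factorial p : ℝ) /
    ((Nat.factorial (2 * p) : ℝ) * Real.pi ^ ((p : ℝ) / 2) *
      ∏ i : Fin p, ∏ j ∈ Finset.Ioi i, ((((j : ℕ) : ℝ) - ((i : ℕ) : ℝ)) *
        (((j : ℕ) : ℝ) + ((i : ℕ) : ℝ) + 1)))

open Classical in
/-- The density `f(t;x)` of the continuous `p`-watermelon with wall condition
at time `t`. -/
noncomputable def fW (p : ℕ) (t : ℝ) (x : Fin p → ℝ) : ℝ :=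
  if (∀ i, 0 ≤ x i) ∧ (∀ i j : Fin p, i ≤ j → x i ≤ x j) then
    cW p * (t * (1 - t)) ^ (-(((p : ℝ) ^ 2) + (p : ℝ) / 2)) *
      (∏ i : Fin p, ∏ j ∈ Finset.Ioi i, ((x j) ^ 2 - (x i) ^ 2) ^ 2) *
      (∏ i : Fin p, (x i) ^ 2) *
      Real.exp (-(∑ i, (x i) ^ 2) / (2 * t * (1 - t)))
  else 0

/-- The number of `±1`-walks of length `m` from `0` to `x`. -/
def walkCount : ℕ → ℤ → ℤ
  | 0, x => if x = 0 then 1 else 0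
  | m + 1, x => walkCount m (x - 1) + walkCount m (x + 1)

theorem walkCount_neg (m : ℕ) (x : ℤ) : walkCount m (-x) = walkCount m x := by
  induction m generalizing x with
  | zero => simp [walkCount]
  | succ m ih =>
    rw [walkCount, walkCount, ← ih (x - 1), ← ih (x + 1), add_comm]
    congr 2 <;> ring

theorem walkCount_eq_zero {m : ℕ} {x : ℤ} (h : (m : ℤ) < x) : walkCount m x = 0 := by
  induction m generalizing x with
  | zero => simp only [walkCount]; rw [if_neg]; push_cast at h; omega
  | succ m ih =>
    push_cast at h
    rw [walkCount, ih (by omega), ih (by omega), add_zero]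

theorem walkCount_self (m : ℕ) : walkCount m m = 1 := by
  induction m with
  | zero => simp [walkCount]
  | succ m ih =>
    rw [walkCount, walkCount_eq_zero (x := ((m + 1 : ℕ) : ℤ) + 1) (by push_cast; omega)]
    push_cast
    simp [ih]

theorem walkCount_add (a b : ℕ) : walkCount (a + b) ((a : ℤ) - b) = (a + b).choose a := by
  induction h : a + b generalizing a b with
  | zero =>
    obtain ⟨rfl, rfl⟩ : a = 0 ∧ b = 0 := by omega
    simp [walkCount]
  | succ m ih =>
    rw [walkCount]
    rcases a with _ | a
    · have hb : b = m + 1 := by omega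
      subst hb
      have h1 := ih 0 m (by omega)
      have h2 : walkCount m (((0 : ℕ) : ℤ) - ((m + 1 : ℕ) : ℤ) - 1) = 0 := by
        rw [← walkCount_neg]; apply walkCount_eq_zero; push_cast; omega
      rw [h2]
      have h3 : ((0 : ℕ) : ℤ) - ((m + 1 : ℕ) : ℤ) + 1 = ((0 : ℕ) : ℤ) - (m : ℤ) := by
        push_cast; ring
      rw [h3, h1]; simp
    · rcases b with _ | b
      · have ha : a = m := by omega
        subst ha
        have h1 := ih a 0 (by omega)
        have h2 : walkCount a (((a + 1 : ℕ) : ℤ) - ((0 : ℕ) : ℤ) + 1) = 0 := by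
          apply walkCount_eq_zero; push_cast; omega
        rw [h2]
        have h3 : ((a + 1 : ℕ) : ℤ) - ((0 : ℕ) : ℤ) - 1 = (a : ℤ) - ((0 : ℕ) : ℤ) := by
          push_cast; ring
        rw [h3, h1]; simp
      · have h1 := ih a (b + 1) (by omega)
        have h2 := ih (a + 1) b (by omega)
        have h3 : ((a + 1 : ℕ) : ℤ) - ((b + 1 : ℕ) : ℤ) - 1 = (a : ℤ) - ((b + 1 : ℕ) : ℤ) := by
          push_cast; ring
        have h4 : ((a + 1 : ℕ) : ℤ) - ((b + 1 : ℕ) : ℤ) + 1 = ((a + 1 : ℕ) : ℤ) - (b : ℤ) := by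
          push_cast; ring
        rw [h3, h4, h1, h2, Nat.choose_succ_succ]
        push_cast; ring

/-- An odd solution of the recurrence of `walkCount`, whose initial value is concentrated on
`[-(2j+1), 2j+1]`. -/
def ballot (j m : ℕ) (x : ℤ) : ℤ :=
  walkCount (m + 2 * j) (x - 1) - walkCount (m + 2 * j) (x + 1)

theorem ballot_succ (j m : ℕ) (x : ℤ) :
    ballot j (m + 1) x = ballot j m (x - 1) + ballot j m (x + 1) := by
  have h : m + 1 + 2 * j = (m + 2 * j) + 1 := by ring
  simp only [ballot, h, walkCount]
  ring_nf

theorem ballot_zero_right (j m : ℕ) : ballot j m 0 = 0 := by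
  have := walkCount_neg (m + 2 * j) 1
  simp [ballot, this]

/-- The matrix whose determinant counts stars with end points `e`. -/
def starMatrix (p m : ℕ) (e : Fin p → ℤ) : Matrix (Fin p) (Fin p) ℤ :=
  fun i j => ballot j m (e i + 1)

theorem two_mul_le_of_strictMono {p : ℕ} {e : Fin p → ℤ} (hpar : ∀ i, 2 ∣ e i)
    (hmono : StrictMono e) (hnn : ∀ i, 0 ≤ e i) (i : Fin p) : 2 * ((i : ℕ) : ℤ) ≤ e i := by
  obtain ⟨i, hi⟩ := i
  induction i with
  | zero => simpa using hnn _
  | succ i ih =>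
    have h1 := ih (by omega)
    have h2 : e ⟨i, by omega⟩ < e ⟨i + 1, hi⟩ := hmono (by simp [Fin.lt_def])
    have h3 := hpar ⟨i, by omega⟩
    have h4 := hpar ⟨i + 1, hi⟩
    simp only at h1 ⊢
    push_cast
    omega

theorem det_starMatrix_zero {p : ℕ} {e : Fin p → ℤ} (hpar : ∀ i, 2 ∣ e i)
    (hmono : StrictMono e) (hnn : ∀ i, 0 ≤ e i) :
    (starMatrix p 0 e).det = if (∀ i, e i = 2 * ((i : ℕ) : ℤ)) then 1 else 0 := by
  have hle := two_mul_le_of_strictMono hpar hmono hnn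
  rw [Matrix.det_of_isUpperTriangular]
  · split_ifs with h
    · apply Finset.prod_eq_one
      intro i _
      rw [starMatrix, h i, ballot, walkCount_eq_zero (x := _ + 1 + 1) (by push_cast; omega)]
      have := walkCount_self (0 + 2 * (i : ℕ))
      push_cast at this ⊢
      simpa using this
    · push Not at h
      obtain ⟨i, hi⟩ := h
      apply Finset.prod_eq_zero (Finset.mem_univ i)
      have := hle i
      rw [starMatrix, ballot, walkCount_eq_zero, walkCount_eq_zero, sub_zero] <;>
        push_cast <;> omega
  · intro i j hij
    have := hle i
    have hij' : (j : ℕ) < i := hij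
    rw [starMatrix, ballot, walkCount_eq_zero, walkCount_eq_zero, sub_zero] <;>
      push_cast <;> omega

theorem det_starMatrix_succ {p : ℕ} (m : ℕ) (e : Fin p → ℤ) :
    (starMatrix p (m + 1) e).det =
      ∑ s : Finset (Fin p),
        (starMatrix p m (s.piecewise (fun i => e i - 1) (fun i => e i + 1))).det := by
  have h : starMatrix p (m + 1) e =
      starMatrix p m (fun i => e i - 1) + starMatrix p m (fun i => e i + 1) := by
    ext i j
    simp only [starMatrix, Matrix.add_apply, ballot_succ]
    congr 2; ring
  rw [h]
  have h2 := (Matrix.detRowAlternating (n := Fin p) (R := ℤ)).toMultilinearMap.map_add_univ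
    (starMatrix p m (fun i => e i - 1)) (starMatrix p m (fun i => e i + 1))
  refine h2.trans (Finset.sum_congr rfl fun s _ => ?_)
  change Matrix.det _ = Matrix.det _
  congr 1
  ext i j
  by_cases hi : i ∈ s <;> simp only [Finset.piecewise, starMatrix, hi, if_true, if_false]

/-- Stars of length `m` with end points `e`. -/
abbrev StarTo (p m : ℕ) (e : Fin p → ℤ) : Type :=
  {w : Fin p → ℕ → ℤ // IsStarW p m w ∧ ∀ i, w i m = e i}

theorem StarTo.nonneg {p m : ℕ} {e : Fin p → ℤ} (w : StarTo p m e) (i : Fin p) : 0 ≤ e i :=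
  w.2.2 i ▸ w.2.1.2.2.1 i m le_rfl

theorem StarTo.strictMono {p m : ℕ} {e : Fin p → ℤ} (w : StarTo p m e) : StrictMono e := by
  intro i j hij
  have := w.2.1.2.2.2.1 i j hij m le_rfl
  rwa [w.2.2 i, w.2.2 j] at this

theorem IsStarW.dvd_sub {p m : ℕ} {w : Fin p → ℕ → ℤ} (h : IsStarW p m w) (i : Fin p) {k : ℕ}
    (hk : k ≤ m) : 2 ∣ w i k - k := by
  induction k with
  | zero => rw [h.1]; simp
  | succ k ih =>
    have h1 := ih (by omega)
    have h2 := h.2.1 i k (by omega)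
    push_cast
    omega

/-- The set of branches going down in the last step. -/
def lastDown {p m : ℕ} {e : Fin p → ℤ} (w : StarTo p (m + 1) e) : Finset (Fin p) :=
  Finset.univ.filter fun i => w.1 i m = e i + 1

/-- Removing the last step of a star. -/
def lastDownFiberEquiv {p m : ℕ} {e : Fin p → ℤ} (hnn : ∀ i, 0 ≤ e i) (hmono : StrictMono e)
    (s : Finset (Fin p)) :
    {w : StarTo p (m + 1) e // lastDown w = s} ≃
      StarTo p m (s.piecewise (fun i => e i + 1) (fun i => e i - 1)) where
  toFun w := ⟨fun i l => if l ≤ m then w.1.1 i l else 0, by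
    obtain ⟨⟨w, ⟨h0, h1, h2, h3, h4⟩, h5⟩, rfl⟩ := w
    refine ⟨⟨?_, ?_, ?_, ?_, ?_⟩, ?_⟩
    · intro i; simpa using h0 i
    · intro i k hk
      simpa [hk.le, Nat.succ_le_of_lt hk] using h1 i k (by omega)
    · intro i k hk
      simpa [hk] using h2 i k (by omega)
    · intro i j hij k hk
      simpa [hk] using h3 i j hij k (by omega)
    · intro i k hk
      simp [hk.not_ge]
    · intro i
      have h6 := h1 i m (by omega)
      rw [h5] at h6
      by_cases hi : w i m = e i + 1
      · simp [Finset.piecewise, lastDown, hi]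
      · simp only [Finset.piecewise, lastDown, Finset.mem_filter, Finset.mem_univ, true_and, hi,
          if_false, le_refl, if_true]
        omega⟩
  invFun w := ⟨⟨fun i l => if l ≤ m then w.1 i l else if l = m + 1 then e i else 0, by
    obtain ⟨w, ⟨h0, h1, h2, h3, h4⟩, h5⟩ := w
    refine ⟨⟨?_, ?_, ?_, ?_, ?_⟩, ?_⟩
    · intro i; simpa using h0 i
    · intro i k hk
      rcases Nat.lt_succ_iff_lt_or_eq.mp hk with hk | rfl
      · simpa [hk.le, Nat.succ_le_of_lt hk] using h1 i k hk
      · simp only [le_refl, if_true, h5 i]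
        by_cases hi : i ∈ s <;> simp [hi]
    · intro i k hk
      dsimp only
      split_ifs with h h'
      · exact h2 i k h
      · exact hnn i
      · exact le_rfl
    · intro i j hij k hk
      rcases hk.lt_or_eq with hk | rfl
      · simpa [Nat.lt_succ_iff.mp hk] using h3 i j hij k (by omega)
      · simpa using hmono hij
    · intro i k hk
      simp [show ¬ k ≤ m by omega, show k ≠ m + 1 by omega]
    · intro i; simp⟩, by
    ext i
    simp only [lastDown, le_refl, if_true, Finset.mem_filter, Finset.mem_univ, true_and, w.2.2 i]
    by_cases hi : i ∈ s
    · simp [hi]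
    · simp only [hi, not_false_eq_true, Finset.piecewise_eq_of_notMem, iff_false]
      omega⟩
  left_inv := by
    rintro ⟨⟨w, ⟨h0, h1, h2, h3, h4⟩, h5⟩, rfl⟩
    apply Subtype.ext
    apply Subtype.ext
    funext i l
    dsimp only
    split_ifs with h h'
    · rfl
    · rw [h', h5]
    · rw [h4 i l (by omega)]
  right_inv := by
    rintro ⟨w, ⟨h0, h1, h2, h3, h4⟩, h5⟩
    apply Subtype.ext
    funext i l
    dsimp only
    split_ifs with h
    · rfl
    · rw [h4 i l (by omega)]

instance StarTo.finite (p m : ℕ) (e : Fin p → ℤ) : Finite (StarTo p m e) := by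
  induction m generalizing e with
  | zero =>
    have : Subsingleton (StarTo p 0 e) := by
      constructor
      rintro ⟨w, ⟨h0, h1, h2, h3, h4⟩, h5⟩ ⟨w', ⟨h0', h1', h2', h3', h4'⟩, h5'⟩
      apply Subtype.ext
      funext i l
      rcases Nat.eq_zero_or_pos l with rfl | hl
      · exact (h0 i).trans (h0' i).symm
      · exact (h4 i l hl).trans (h4' i l hl).symm
    infer_instance
  | succ m ih =>
    by_cases h : (∀ i, 0 ≤ e i) ∧ StrictMono e
    · have : ∀ s, Finite {w : StarTo p (m + 1) e // lastDown w = s} := fun s =>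
        Finite.of_equiv _ (lastDownFiberEquiv h.1 h.2 s).symm
      exact Finite.of_equiv _ (Equiv.sigmaFiberEquiv (lastDown (p := p) (m := m) (e := e)))
    · have : IsEmpty (StarTo p (m + 1) e) := ⟨fun w => h ⟨w.nonneg, w.strictMono⟩⟩
      infer_instance

theorem card_starTo_succ {p m : ℕ} {e : Fin p → ℤ} (hnn : ∀ i, 0 ≤ e i) (hmono : StrictMono e) :
    Nat.card (StarTo p (m + 1) e) = ∑ s : Finset (Fin p),
      Nat.card (StarTo p m (s.piecewise (fun i => e i - 1) (fun i => e i + 1))) := by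
  rw [← Nat.card_congr (Equiv.sigmaFiberEquiv (lastDown (p := p) (m := m) (e := e))),
    Nat.card_sigma, ← Equiv.sum_comp (compl_involutive (α := Finset (Fin p))).toPerm]
  refine Finset.sum_congr rfl fun s _ => ?_
  rw [Nat.card_congr (lastDownFiberEquiv hnn hmono _)]
  have h : sᶜ.piecewise (fun i => e i + 1) (fun i => e i - 1) =
      s.piecewise (fun i => e i - 1) (fun i => e i + 1) := by
    funext i; by_cases hi : i ∈ s <;> simp [hi]
  rw [Function.Involutive.coe_toPerm, h]

theorem card_starTo_eq_det {p m : ℕ} {e : Fin p → ℤ} (hpar : ∀ i, 2 ∣ e i - m)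
    (hnn : ∀ i, 0 ≤ e i) (hmono : StrictMono e) :
    (Nat.card (StarTo p m e) : ℤ) = (starMatrix p m e).det := by
  induction m generalizing e with
  | zero =>
    rw [det_starMatrix_zero (by simpa using hpar) hmono hnn]
    split_ifs with h
    · rw [Nat.cast_eq_one, Nat.card_eq_one_iff_exists]
      refine ⟨⟨fun i l => if l = 0 then e i else 0, ⟨?_, ?_, ?_, ?_, ?_⟩, ?_⟩, ?_⟩
      · simpa using h
      · intro i k hk; omega
      · intro i k hk; simpa [Nat.le_zero.mp hk] using hnn i
      · intro i j hij k hk; simpa [Nat.le_zero.mp hk] using hmono hij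
      · intro i k hk; simp [hk.ne']
      · simp
      · rintro ⟨w, ⟨h0, h1, h2, h3, h4⟩, h5⟩
        apply Subtype.ext
        funext i l
        rcases Nat.eq_zero_or_pos l with rfl | hl
        · simp [h5]
        · simp [h4 i l hl, hl.ne']
    · rw [Nat.cast_eq_zero, Nat.card_eq_zero]
      left
      refine ⟨fun w => h fun i => ?_⟩
      rw [← w.2.2 i, w.2.1.1]
  | succ m ih =>
    rw [card_starTo_succ hnn hmono, det_starMatrix_succ]
    push_cast
    refine Finset.sum_congr rfl fun s _ => ?_
    set e' : Fin p → ℤ := s.piecewise (fun i => e i - 1) (fun i => e i + 1) with he'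
    have hval : ∀ i, e' i = e i - 1 ∨ e' i = e i + 1 := by
      intro i; by_cases hi : i ∈ s <;> simp [he', hi]
    by_cases hnn' : ∀ i, 0 ≤ e' i
    · by_cases hmono' : StrictMono e'
      · refine ih (fun i => ?_) hnn' hmono'
        have h1 := hpar i
        push_cast at h1
        rcases hval i with h | h <;> rw [h] <;> omega
      · have : IsEmpty (StarTo p m e') := ⟨fun w => hmono' w.strictMono⟩
        rw [Nat.card_of_isEmpty, Nat.cast_zero]
        simp only [StrictMono, not_forall] at hmono'
        obtain ⟨i, j, hij, h⟩ := hmono'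
        have heq : e' i = e' j := by
          have h1 := hpar i
          have h2 := hpar j
          have h3 := hmono hij
          rcases hval i with h4 | h4 <;> rcases hval j with h5 | h5 <;> omega
        symm
        apply Matrix.det_zero_of_row_eq hij.ne
        funext l
        simp [starMatrix, heq]
    · have : IsEmpty (StarTo p m e') := ⟨fun w => hnn' w.nonneg⟩
      rw [Nat.card_of_isEmpty, Nat.cast_zero]
      push Not at hnn'
      obtain ⟨i, hi⟩ := hnn'
      have h1 : e' i + 1 = 0 := by
        have := hnn i
        rcases hval i with h | h <;> omega
      symm
      apply Matrix.det_eq_zero_of_row_eq_zero i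
      intro j
      rw [starMatrix, h1, ballot_zero_right]

/-- Cutting a watermelon at time `k` into two stars. -/
def melonCutEquiv {p n k : ℕ} (hk : k ≤ 2 * n) (e : Fin p → ℤ) :
    {w : Fin p → ℕ → ℤ // IsMelonW p n w ∧ ∀ i, w i k = e i} ≃
      StarTo p k e × StarTo p (2 * n - k) e where
  toFun w := ⟨⟨fun i l => if l ≤ k then w.1 i l else 0, by
      obtain ⟨w, ⟨⟨h0, h1, h2, h3, h4⟩, h5⟩, h6⟩ := w
      refine ⟨⟨?_, ?_, ?_, ?_, ?_⟩, ?_⟩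
      · intro i; simpa using h0 i
      · intro i l hl
        simpa [hl.le, Nat.succ_le_of_lt hl] using h1 i l (by omega)
      · intro i l hl
        simpa [hl] using h2 i l (by omega)
      · intro i j hij l hl
        simpa [hl] using h3 i j hij l (by omega)
      · intro i l hl
        simp [hl.not_ge]
      · simpa using h6⟩,
    ⟨fun i l => if l ≤ 2 * n - k then w.1 i (2 * n - l) else 0, by
      obtain ⟨w, ⟨⟨h0, h1, h2, h3, h4⟩, h5⟩, h6⟩ := w
      refine ⟨⟨?_, ?_, ?_, ?_, ?_⟩, ?_⟩
      · intro i; simpa using h5 i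
      · intro i l hl
        have h := h1 i (2 * n - (l + 1)) (by omega)
        rw [show 2 * n - (l + 1) + 1 = 2 * n - l by omega] at h
        simp only [hl.le, Nat.succ_le_of_lt hl, if_true]
        omega
      · intro i l hl
        simpa [hl] using h2 i (2 * n - l) (by omega)
      · intro i j hij l hl
        simpa [hl] using h3 i j hij (2 * n - l) (by omega)
      · intro i l hl
        simp [hl.not_ge]
      · intro i
        simpa [show 2 * n - (2 * n - k) = k by omega] using h6 i⟩⟩
  invFun q := ⟨fun i l => if l ≤ k then q.1.1 i l else if l ≤ 2 * n then q.2.1 i (2 * n - l) else 0,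
    by
      obtain ⟨⟨w, ⟨h0, h1, h2, h3, h4⟩, h5⟩, ⟨w', ⟨h0', h1', h2', h3', h4'⟩, h5'⟩⟩ := q
      refine ⟨⟨⟨?_, ?_, ?_, ?_, ?_⟩, ?_⟩, ?_⟩
      · intro i; simpa using h0 i
      · intro i l hl
        rcases lt_trichotomy l k with hlk | rfl | hlk
        · simpa [hlk.le, Nat.succ_le_of_lt hlk] using h1 i l hlk
        · have h := h1' i (2 * n - (l + 1)) (by omega)
          rw [show 2 * n - (l + 1) + 1 = 2 * n - l by omega, h5', ← h5] at h
          simp only [show ¬ l + 1 ≤ l by omega, le_refl, if_true, if_false, Nat.succ_le_of_lt hl]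
          omega
        · have h := h1' i (2 * n - (l + 1)) (by omega)
          rw [show 2 * n - (l + 1) + 1 = 2 * n - l by omega] at h
          simp only [show ¬ l + 1 ≤ k by omega, show ¬ l ≤ k by omega, hl.le, if_true, if_false,
            Nat.succ_le_of_lt hl]
          omega
      · intro i l hl
        dsimp only
        split_ifs with h
        · exact h2 i l h
        · exact h2' i _ (by omega)
      · intro i j hij l hl
        dsimp only
        split_ifs with h
        · exact h3 i j hij l h
        · exact h3' i j hij _ (by omega)
      · intro i l hl
        simp [show ¬ l ≤ k by omega, show ¬ l ≤ 2 * n by omega]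
      · intro i
        rcases hk.eq_or_lt with rfl | hk
        · have h := h5' i
          simp only [Nat.sub_self, h0'] at h
          simp [h5, h]
        · simp [hk, h0']
      · simpa using h5⟩
  left_inv := by
    rintro ⟨w, ⟨⟨h0, h1, h2, h3, h4⟩, h5⟩, h6⟩
    apply Subtype.ext
    funext i l
    dsimp only
    split_ifs with h h' h''
    · rfl
    · rw [show 2 * n - (2 * n - l) = l by omega]
    · omega
    · rw [h4 i l (by omega)]
  right_inv := by
    rintro ⟨⟨w, ⟨h0, h1, h2, h3, h4⟩, h5⟩, ⟨w', ⟨h0', h1', h2', h3', h4'⟩, h5'⟩⟩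
    refine Prod.ext (Subtype.ext ?_) (Subtype.ext ?_)
    · funext i l
      dsimp only
      split_ifs with h
      · rfl
      · rw [h4 i l (by omega)]
    · funext i l
      dsimp only
      split_ifs with h h' h''
      · rw [show 2 * n - l = k by omega, show l = 2 * n - k by omega, h5, h5']
      · rw [show 2 * n - (2 * n - l) = l by omega]
      · omega
      · rw [h4' i l (by omega)]

theorem card_melon_at {p n k : ℕ} (hk : k ≤ 2 * n) (e : Fin p → ℤ) :
    Nat.card {w : Fin p → ℕ → ℤ // IsMelonW p n w ∧ ∀ i, w i k = e i} =
      Nat.card (StarTo p k e) * Nat.card (StarTo p (2 * n - k) e) := by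
  rw [Nat.card_congr (melonCutEquiv hk e), Nat.card_prod]

theorem card_melon (p n : ℕ) : Nat.card {w : Fin p → ℕ → ℤ // IsMelonW p n w} =
    Nat.card (StarTo p (2 * n) fun i => 2 * ((i : ℕ) : ℤ)) := rfl

open Finset in
theorem prod_Ioi_rev {M : Type*} [CommMonoid M] {p : ℕ} (f : Fin p → Fin p → M) :
    ∏ i : Fin p, ∏ j ∈ Ioi i, f (Fin.rev j) (Fin.rev i) = ∏ i : Fin p, ∏ j ∈ Ioi i, f i j := by
  rw [Finset.prod_sigma', Finset.prod_sigma']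
  refine Finset.prod_bij' (fun q _ => ⟨Fin.rev q.2, Fin.rev q.1⟩)
    (fun q _ => ⟨Fin.rev q.2, Fin.rev q.1⟩) ?_ ?_ ?_ ?_ ?_ <;> simp

/-- A Vandermonde evaluation in which the degrees of the columns decrease. -/
theorem det_prod_add {p : ℕ} (u : Fin p → ℝ) (c : ℕ → ℝ) :
    Matrix.det (Matrix.of fun i j : Fin p => ∏ l ∈ Finset.Ico ((j : ℕ) + 1) p, (u i + c l)) =
      ∏ i : Fin p, ∏ j ∈ Finset.Ioi i, (u i - u j) := by
  let P : Fin p → Polynomial ℝ := fun j =>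
    ∏ l ∈ Finset.Ico ((Fin.rev j : ℕ) + 1) p, (Polynomial.X + Polynomial.C (c l))
  have hmonic : ∀ j, (P j).Monic := fun j =>
    Polynomial.monic_prod_of_monic _ _ fun l _ => Polynomial.monic_X_add_C _
  have hdeg : ∀ j, (P j).natDegree = j := fun j => by
    rw [Polynomial.natDegree_prod_of_monic _ _ fun l _ => Polynomial.monic_X_add_C _]
    simp only [Polynomial.natDegree_X_add_C, Finset.sum_const, Nat.card_Ico, Fin.val_rev,
      smul_eq_mul, mul_one]
    have := j.2
    omega
  have h := Matrix.det_eval_matrixOfPolynomials_eq_det_vandermonde (fun i => u (Fin.rev i)) P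
    hdeg hmonic
  rw [Matrix.det_vandermonde, prod_Ioi_rev (fun i j => u i - u j)] at h
  rw [h, ← Matrix.det_submatrix_equiv_self Fin.revPerm]
  congr 1
  ext i j
  simp [P, Polynomial.eval_prod]

theorem ballot_eq (j m a b : ℕ) (h : a + b = m + 2 * j + 1) :
    (ballot j m ((a : ℤ) - b) : ℝ) =
      ((a : ℝ) - b) * (m + 2 * j).factorial / (a.factorial * b.factorial) := by
  have key : ∀ c d : ℕ, c + d = m + 2 * j → ((c + d).choose c : ℝ) =
      (m + 2 * j).factorial / (c.factorial * d.factorial) := fun c d hcd => by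
    rw [Nat.cast_add_choose, hcd]
  have h1 : (walkCount (m + 2 * j) ((a : ℤ) - b - 1) : ℝ) =
      a * (m + 2 * j).factorial / (a.factorial * b.factorial) := by
    rcases a with _ | a
    · rw [← walkCount_neg, walkCount_eq_zero (by push_cast; omega)]; simp
    · rw [show ((a + 1 : ℕ) : ℤ) - b - 1 = (a : ℤ) - b by push_cast; ring,
        show m + 2 * j = a + b by omega, walkCount_add, Int.cast_natCast, key a b (by omega),
        show m + 2 * j = a + b by omega, Nat.factorial_succ]
      have := Nat.factorial_pos a
      push_cast
      field_simp
  have h2 : (walkCount (m + 2 * j) ((a : ℤ) - b + 1) : ℝ) =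
      b * (m + 2 * j).factorial / (a.factorial * b.factorial) := by
    rcases b with _ | b
    · rw [walkCount_eq_zero (by push_cast; omega)]; simp
    · rw [show (a : ℤ) - ((b + 1 : ℕ) : ℤ) + 1 = (a : ℤ) - b by push_cast; ring,
        show m + 2 * j = a + b by omega, walkCount_add, Int.cast_natCast, key a b (by omega),
        show m + 2 * j = a + b by omega, Nat.factorial_succ]
      push_cast
      field_simp
  rw [ballot, Int.cast_sub, h1, h2]
  ring

theorem factorial_eq_mul_prod_Ico (a j p : ℕ) (hj : j + 1 ≤ p) :
    ((a + (p - 1)).factorial : ℝ) =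
      (a + j).factorial * ∏ l ∈ Finset.Ico (j + 1) p, ((a : ℝ) + l) := by
  induction p, hj using Nat.le_induction with
  | base => simp
  | succ p hp ih =>
    rw [Finset.prod_Ico_succ_top hp, ← mul_assoc, ← ih,
      show a + (p + 1 - 1) = a + (p - 1) + 1 by omega,
      Nat.factorial_succ, show a + (p - 1) + 1 = a + p by omega]
    push_cast
    ring

/-- The number of stars with given end points, as a product. -/
theorem card_starTo_eq_prod {p m : ℕ} (a b : Fin p → ℕ) (hab : ∀ i, a i + b i = m + 1)
    (hnn : ∀ i, b i + 1 ≤ a i) (hmono : StrictMono a) :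
    (Nat.card (StarTo p m fun i => (a i : ℤ) - b i - 1) : ℝ) =
      (∏ i : Fin p, ((m + 2 * i).factorial : ℝ) / (m + 2 * p - 1).factorial) *
      (∏ i : Fin p, ((a i : ℝ) - b i) * (m + 2 * p - 1).choose (a i + (p - 1))) *
      ∏ i : Fin p, ∏ j ∈ Finset.Ioi i, (((a j : ℝ) - b j) ^ 2 - ((a i : ℝ) - b i) ^ 2) / 4 := by
  have h1 := card_starTo_eq_det (p := p) (m := m) (e := fun i => (a i : ℤ) - b i - 1)
    (fun i => by have := hab i; omega) (fun i => by have := hnn i; omega)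
    (fun i j hij => by have := hmono hij; have := hab i; have := hab j; dsimp only; omega)
  have h2 : (Nat.card (StarTo p m fun i => (a i : ℤ) - b i - 1) : ℝ) =
      (Matrix.det ((starMatrix p m fun i => (a i : ℤ) - b i - 1).map (Int.castRingHom ℝ))) := by
    rw [← RingHom.mapMatrix_apply, ← RingHom.map_det, ← h1]; simp
  have h3 : (starMatrix p m fun i => (a i : ℤ) - b i - 1).map (Int.castRingHom ℝ) =
      Matrix.of fun i j : Fin p => (((a i : ℝ) - b i) * (m + 2 * p - 1).choose (a i + (p - 1))) *
        (Matrix.of fun i j : Fin p => ((m + 2 * j).factorial / (m + 2 * p - 1).factorial : ℝ) *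
          (Matrix.of fun i j : Fin p => ∏ l ∈ Finset.Ico ((j : ℕ) + 1) p,
            ((a i : ℝ) * b i + (l * (m + 1) + l ^ 2))) i j) i j := by
    ext i j
    have hj := j.2
    have habi := hab i
    have habr : (a i : ℝ) + b i = m + 1 := by exact_mod_cast habi
    simp only [Matrix.map_apply, Matrix.of_apply, starMatrix]
    rw [show (a i : ℤ) - b i - 1 + 1 = ((a i + j : ℕ) : ℤ) - ((b i + j : ℕ) : ℤ) by
      push_cast; ring, eq_intCast, ballot_eq _ _ _ _ (by omega),
      show m + 2 * p - 1 = (a i + (p - 1)) + (b i + (p - 1)) by omega, Nat.cast_add_choose,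
      factorial_eq_mul_prod_Ico (a i) j p hj, factorial_eq_mul_prod_Ico (b i) j p hj]
    have h4 : ∏ l ∈ Finset.Ico ((j : ℕ) + 1) p, ((a i : ℝ) * b i + (l * (m + 1) + l ^ 2)) =
        (∏ l ∈ Finset.Ico ((j : ℕ) + 1) p, ((a i : ℝ) + l)) *
          ∏ l ∈ Finset.Ico ((j : ℕ) + 1) p, ((b i : ℝ) + l) := by
      rw [← Finset.prod_mul_distrib]
      refine Finset.prod_congr rfl fun l _ => ?_
      rw [← habr]; ring
    have h5 : ∀ c : ℕ, ∏ l ∈ Finset.Ico ((j : ℕ) + 1) p, ((c : ℝ) + l) ≠ 0 := fun c => by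
      refine (Finset.prod_pos fun l hl => ?_).ne'
      have : 0 < l := by have := (Finset.mem_Ico.mp hl).1; omega
      positivity
    have h6 := h5 (a i)
    have h7 := h5 (b i)
    rw [h4]
    push_cast
    field_simp
    ring
  rw [h2, h3, Matrix.det_mul_column, Matrix.det_mul_row, det_prod_add]
  have h8 : ∀ i j : Fin p, (a i : ℝ) * b i - a j * b j =
      (((a j : ℝ) - b j) ^ 2 - ((a i : ℝ) - b i) ^ 2) / 4 := fun i j => by
    have hi : (b i : ℝ) = m + 1 - a i := by
      rw [eq_sub_iff_add_eq]
      exact_mod_cast (add_comm _ _).trans (hab i)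
    have hj : (b j : ℝ) = m + 1 - a j := by
      rw [eq_sub_iff_add_eq]
      exact_mod_cast (add_comm _ _).trans (hab j)
    rw [hi, hj]; ring
  simp only [h8]
  ring

open Real in
theorem abs_entropy_sub_sq_le {s : ℝ} (hs : |s| ≤ 1 / 2) :
    |((1 + s) * log (1 + s) + (1 - s) * log (1 - s)) - s ^ 2| ≤ 4 * |s| ^ 3 := by
  have hs1 : |s| < 1 := by linarith
  have h : ∀ r : ℝ, |r| ≤ 1 / 2 → |r + r ^ 2 / 2 + log (1 - r)| ≤ 2 * |r| ^ 3 := fun r hr => by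
    have h := abs_log_sub_add_sum_range_le (show |r| < 1 by linarith) 2
    simp only [Finset.sum_range_succ, Finset.sum_range_zero] at h
    norm_num at h
    refine h.trans ?_
    rw [div_le_iff₀ (by linarith)]
    nlinarith [pow_nonneg (abs_nonneg r) 3]
  have hA := h s hs
  have hB := h (-s) (by rwa [abs_neg])
  rw [abs_neg, sub_neg_eq_add] at hB
  have h1 : 0 ≤ 1 + s := by linarith [neg_abs_le s]
  have h2 : 0 ≤ 1 - s := by linarith [le_abs_self s]
  have heq : ((1 + s) * log (1 + s) + (1 - s) * log (1 - s)) - s ^ 2 =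
      (1 + s) * (-s + (-s) ^ 2 / 2 + log (1 + s)) + (1 - s) * (s + s ^ 2 / 2 + log (1 - s)) := by
    ring
  rw [heq]
  refine (abs_add_le _ _).trans ?_
  rw [abs_mul, abs_mul, abs_of_nonneg h1, abs_of_nonneg h2]
  nlinarith [mul_le_mul_of_nonneg_left hA h2, mul_le_mul_of_nonneg_left hB h1]

open Real in
theorem choose_eq_stirlingSeq {a b : ℕ} (ha : 0 < a) (hb : 0 < b) :
    ((a + b).choose a : ℝ) * √((a : ℝ) + b) / 2 ^ (a + b) =
      Stirling.stirlingSeq (a + b) / (Stirling.stirlingSeq a * Stirling.stirlingSeq b) *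
      √(1 / (2 * ((a / (a + b)) * (b / (a + b))))) *
      exp (-(a * log (2 * a / (a + b)) + b * log (2 * b / (a + b)))) := by
  have ha' : (0 : ℝ) < a := by exact_mod_cast ha
  have hb' : (0 : ℝ) < b := by exact_mod_cast hb
  have hpow : ∀ {n : ℕ}, 0 < n → (n : ℝ) ^ n = exp (n * log n) := fun {n} hn => by
    rw [mul_comm, exp_mul, exp_log (by exact_mod_cast hn), rpow_natCast]
  have hE : exp (-(a * log (2 * a / (a + b)) + b * log (2 * b / (a + b)))) =
      ((a : ℝ) + b) ^ (a + b) / (2 ^ (a + b) * (a : ℝ) ^ a * (b : ℝ) ^ b) := by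
    have h2 : (2 : ℝ) ^ (a + b) = exp ((a + b) * log 2) := by
      rw [mul_comm, exp_mul, exp_log two_pos]; exact_mod_cast rfl
    have h3 := hpow (n := a + b) (by omega)
    push_cast at h3
    rw [h2, h3, hpow ha, hpow hb, ← exp_add, ← exp_add, ← exp_sub]
    congr 1
    rw [log_div (by positivity) (by positivity), log_div (by positivity) (by positivity),
      log_mul (by positivity) (by positivity), log_mul (by positivity) (by positivity)]
    ring
  have hs : √(1 / (2 * ((a / (a + b)) * (b / (a + b))))) =
      √(2 * ((a : ℝ) + b)) * √((a : ℝ) + b) / (√(2 * a) * √(2 * b)) := by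
    rw [← sqrt_mul (by positivity), ← sqrt_mul (by positivity), ← sqrt_div (by positivity)]
    congr 1
    field_simp
  rw [hE, hs, Nat.cast_add_choose]
  simp only [Stirling.stirlingSeq]
  have h1 : √(2 * (a : ℝ)) ≠ 0 := by positivity
  have h2 : √(2 * (b : ℝ)) ≠ 0 := by positivity
  have h3 : √(2 * ((a : ℝ) + b)) ≠ 0 := by positivity
  push_cast
  simp only [div_pow, pow_add]
  field_simp

open Real in
theorem tendsto_choose_mul_sqrt {a b : ℕ → ℕ} {y : ℝ}
    (hR : Tendsto (fun n => (a n : ℝ) + b n) atTop atTop)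
    (hy : Tendsto (fun n => ((a n : ℝ) - b n) / √((a n : ℝ) + b n)) atTop (nhds y)) :
    Tendsto (fun n => ((a n + b n).choose (a n) : ℝ) * √((a n : ℝ) + b n) / 2 ^ (a n + b n)) atTop
      (nhds (√(2 / π) * exp (-(y ^ 2 / 2)))) := by
  have hsR : Tendsto (fun n => √((a n : ℝ) + b n)) atTop atTop := tendsto_sqrt_atTop.comp hR
  have hRpos : ∀ᶠ n in atTop, 0 < (a n : ℝ) + b n := hR.eventually_gt_atTop 0
  set s : ℕ → ℝ := fun n => ((a n : ℝ) - b n) / ((a n : ℝ) + b n) with hs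
  have hs0 : Tendsto s atTop (nhds 0) := by
    refine (hy.div_atTop hsR).congr' ?_
    filter_upwards [hRpos] with n hn
    rw [div_div, mul_self_sqrt hn.le]
  have hA : Tendsto (fun n => (a n : ℝ) / (a n + b n)) atTop (nhds (1 / 2)) := by
    have h := (hs0.const_add 1).div_const 2
    rw [add_zero] at h
    refine h.congr' ?_
    filter_upwards [hRpos] with n hn
    simp only [hs]; field_simp; ring
  have hB : Tendsto (fun n => (b n : ℝ) / (a n + b n)) atTop (nhds (1 / 2)) := by
    have h := (hs0.const_sub 1).div_const 2
    rw [sub_zero] at h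
    refine h.congr' ?_
    filter_upwards [hRpos] with n hn
    simp only [hs]; field_simp; ring
  have haT : Tendsto a atTop atTop := by
    rw [← tendsto_natCast_atTop_iff (R := ℝ)]
    refine (hR.atTop_mul_pos (by norm_num) hA).congr' ?_
    filter_upwards [hRpos] with n hn
    field_simp
  have hbT : Tendsto b atTop atTop := by
    rw [← tendsto_natCast_atTop_iff (R := ℝ)]
    refine (hR.atTop_mul_pos (by norm_num) hB).congr' ?_
    filter_upwards [hRpos] with n hn
    field_simp
  have hS := Stirling.tendsto_stirlingSeq_sqrt_pi
  have hratio := (hS.comp (haT.atTop_add_atTop hbT)).div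
    ((hS.comp haT).mul (hS.comp hbT)) (by positivity)
  have hroot : Tendsto (fun n => √(1 / (2 * (((a n : ℝ) / (a n + b n)) * (b n / (a n + b n))))))
      atTop (nhds √(1 / (2 * ((1 / 2) * (1 / 2))))) :=
    ((tendsto_const_nhds.div ((hA.mul hB).const_mul 2)
      (by norm_num : (2 : ℝ) * (1 / 2 * (1 / 2)) ≠ 0))).sqrt
  have hexp : Tendsto (fun n => (a n : ℝ) * log (2 * a n / (a n + b n)) +
      b n * log (2 * b n / (a n + b n))) atTop (nhds (y ^ 2 / 2)) := by
    have hy2 := (hy.pow 2).div_const 2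
    have herr := ((hy.pow 2).const_mul 2).mul hs0.abs
    rw [abs_zero, mul_zero] at herr
    have hdiff : Tendsto (fun n => ((a n : ℝ) * log (2 * a n / (a n + b n)) +
        b n * log (2 * b n / (a n + b n))) - (((a n : ℝ) - b n) / √((a n : ℝ) + b n)) ^ 2 / 2)
        atTop (nhds 0) := by
      refine squeeze_zero_norm' ?_ herr
      have hsmall : ∀ᶠ n in atTop, |s n| < 1 / 2 := by
        have := hs0.abs; rw [abs_zero] at this
        exact this.eventually_lt_const (by norm_num)
      filter_upwards [hRpos, hsmall] with n hn hsn
      have h := abs_entropy_sub_sq_le hsn.le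
      set R : ℝ := (a n : ℝ) + b n with hRdef
      have e1 : 2 * (a n : ℝ) / R = 1 + s n := by
        simp only [hs]; rw [← hRdef]; field_simp; rw [hRdef]; ring
      have e2 : 2 * (b n : ℝ) / R = 1 - s n := by
        simp only [hs]; rw [← hRdef]; field_simp; rw [hRdef]; ring
      have e3 : (a n : ℝ) = R / 2 * (1 + s n) := by rw [← e1]; field_simp
      have e4 : (b n : ℝ) = R / 2 * (1 - s n) := by rw [← e2]; field_simp
      have e5 : (((a n : ℝ) - b n) / √R) ^ 2 = R * s n ^ 2 := by
        rw [div_pow, sq_sqrt hn.le]; simp only [hs]; rw [← hRdef]; field_simp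
      rw [e5, e1, e2]
      have e6 : (a n : ℝ) * log (1 + s n) + b n * log (1 - s n) - R * s n ^ 2 / 2 =
          R / 2 * (((1 + s n) * log (1 + s n) + (1 - s n) * log (1 - s n)) - s n ^ 2) := by
        conv_lhs => rw [e3, e4]
        ring
      rw [e6, Real.norm_eq_abs, abs_mul, abs_of_pos (half_pos hn)]
      calc R / 2 * _ ≤ R / 2 * (4 * |s n| ^ 3) := by gcongr
        _ = 2 * (R * s n ^ 2) * |s n| := by rw [← sq_abs (s n)]; ring
    simpa using hdiff.add hy2
  have hmain := (hratio.mul hroot).mul hexp.neg.rexp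
  have hlim : √π / (√π * √π) * √(1 / (2 * ((1 / 2) * (1 / 2)))) * exp (-(y ^ 2 / 2)) =
      √(2 / π) * exp (-(y ^ 2 / 2)) := by
    rw [sqrt_div two_pos.le]
    norm_num
    field_simp
  rw [hlim] at hmain
  refine hmain.congr' ?_
  filter_upwards [haT.eventually_gt_atTop 0, hbT.eventually_gt_atTop 0] with n ha hb
  exact (choose_eq_stirlingSeq ha hb).symm

open Real in
theorem tendsto_choose_mul_sqrt_scaled {a b : ℕ → ℕ} {M : ℕ → ℝ} {y τ : ℝ} (hτ : 0 < τ)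
    (hM : Tendsto M atTop atTop)
    (hR : Tendsto (fun n => ((a n : ℝ) + b n) / M n) atTop (nhds τ))
    (hy : Tendsto (fun n => ((a n : ℝ) - b n) / √(M n)) atTop (nhds y)) :
    Tendsto (fun n => ((a n + b n).choose (a n) : ℝ) * √(M n) / 2 ^ (a n + b n)) atTop
      (nhds (√(2 / π) / √τ * exp (-(y ^ 2 / (2 * τ))))) := by
  have hMpos := hM.eventually_gt_atTop 0
  have hRT : Tendsto (fun n => (a n : ℝ) + b n) atTop atTop := by
    refine (hM.atTop_mul_pos hτ hR).congr' ?_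
    filter_upwards [hMpos] with n hn
    field_simp
  have hRpos := hRT.eventually_gt_atTop 0
  have hq : Tendsto (fun n => √(M n) / √((a n : ℝ) + b n)) atTop (nhds (1 / √τ)) := by
    refine (tendsto_const_nhds.div hR.sqrt (by positivity)).congr' ?_
    filter_upwards [hMpos, hRpos] with n hn hn'
    rw [Pi.div_apply, sqrt_div hn'.le, one_div_div]
  have hy' : Tendsto (fun n => ((a n : ℝ) - b n) / √((a n : ℝ) + b n)) atTop
      (nhds (y * (1 / √τ))) := by
    refine (hy.mul hq).congr' ?_
    filter_upwards [hMpos, hRpos] with n hn hn'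
    have := sqrt_pos.mpr hn
    field_simp
  have h := (tendsto_choose_mul_sqrt hRT hy').mul hq
  have hlim : √(2 / π) * exp (-((y * (1 / √τ)) ^ 2 / 2)) * (1 / √τ) =
      √(2 / π) / √τ * exp (-(y ^ 2 / (2 * τ))) := by
    rw [mul_pow, div_pow, sq_sqrt hτ.le]
    rw [show y ^ 2 * (1 ^ 2 / τ) / 2 = y ^ 2 / (2 * τ) by field_simp]
    ring
  rw [hlim] at h
  refine h.congr' ?_
  filter_upwards [hRpos] with n hn'
  have := sqrt_pos.mpr hn'
  field_simp

theorem exists_choose_mul_sqrt_le {R : ℕ → ℕ} {M : ℕ → ℝ} {τ : ℝ} (hτ : 0 < τ)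
    (hM : Tendsto M atTop atTop) (hR : Tendsto (fun n => (R n : ℝ) / M n) atTop (nhds τ)) :
    ∃ C, ∀ᶠ n in atTop, ∀ c, ((R n).choose c : ℝ) * √(M n) / 2 ^ (R n) ≤ C := by
  have hsM : Tendsto (fun n => √(M n)) atTop atTop := Real.tendsto_sqrt_atTop.comp hM
  have hsum : ∀ n, R n / 2 + (R n - R n / 2) = R n := fun n => by omega
  have hy : Tendsto (fun n => (((R n / 2 : ℕ) : ℝ) - ((R n - R n / 2 : ℕ) : ℝ)) / √(M n)) atTop
      (nhds 0) := by
    refine squeeze_zero_norm' ?_ (tendsto_const_nhds.div_atTop hsM : Tendsto (fun n => 1 / √(M n))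
      atTop (nhds 0))
    filter_upwards with n
    rw [norm_div, Real.norm_of_nonneg (Real.sqrt_nonneg _)]
    gcongr
    rcases Nat.even_or_odd' (R n) with ⟨r, hr | hr⟩
    · rw [show R n / 2 = r by omega, show R n - r = r by omega]; simp
    · rw [show R n / 2 = r by omega, show R n - r = r + 1 by omega]; simp
  have h := tendsto_choose_mul_sqrt_scaled hτ hM (a := fun n => R n / 2)
    (b := fun n => R n - R n / 2) (hR.congr fun n => by rw [← Nat.cast_add, hsum]) hy
  simp only [hsum] at h
  obtain ⟨C, hC⟩ := h.isBoundedUnder_le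
  refine ⟨C, (Filter.eventually_map.mp hC).mono fun n hn c => le_trans ?_ hn⟩
  gcongr
  exact_mod_cast Nat.choose_le_middle _ _

theorem tendsto_pow_mul_factorial_div (a b : ℕ) :
    Tendsto (fun m : ℕ => (m : ℝ) ^ b * ((m + a).factorial / (m + (a + b)).factorial : ℝ)) atTop
      (nhds 1) := by
  induction b with
  | zero =>
    refine tendsto_const_nhds.congr fun m => ?_
    have : ((m + a).factorial : ℝ) ≠ 0 := by positivity
    simp [this]
  | succ b ih =>
    have h : Tendsto (fun m : ℕ => (m : ℝ) / (m + ((a + b + 1 : ℕ) : ℝ))) atTop (nhds 1) :=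
      tendsto_natCast_div_add_atTop _
    have h2 := ih.mul h
    rw [one_mul] at h2
    refine h2.congr fun m => ?_
    rw [show m + (a + (b + 1)) = (m + (a + b)) + 1 by ring, Nat.factorial_succ]
    have : ((m + (a + b)).factorial : ℝ) ≠ 0 := by positivity
    push_cast
    have : (m : ℝ) + a + b + 1 ≠ 0 := by positivity
    field_simp
    ring

theorem card_subtype_and_eq_sum_fiber {α β : Type*} [DecidableEq β] {P Q : α → Prop}
    (hfin : Finite {a // P a}) (f : α → β) (E : Finset β) (h : ∀ a, P a → (Q a ↔ f a ∈ E)) :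
    Nat.card {a // P a ∧ Q a} = ∑ b ∈ E, Nat.card {a // P a ∧ f a = b} := by
  classical
  have hS : {a | P a}.Finite := hfin
  rw [Nat.subtype_card (hS.toFinset.filter Q) (by simp),
    Finset.card_eq_sum_card_fiberwise (f := f) (t := E)
      (fun a ha => by
        simp only [Finset.coe_filter, Set.Finite.mem_toFinset, Set.mem_ofPred_eq] at ha
        exact (h a ha.1).mp ha.2)]
  refine Finset.sum_congr rfl fun b hb => ?_
  rw [Nat.subtype_card ((hS.toFinset.filter Q).filter fun a => f a = b)]
  intro a
  simp only [Finset.mem_filter, Set.Finite.mem_toFinset, Set.mem_ofPred_eq]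
  constructor
  · rintro ⟨⟨h1, -⟩, h2⟩; exact ⟨h1, h2⟩
  · rintro ⟨h1, h2⟩; exact ⟨⟨h1, (h a h1).mpr (h2 ▸ hb)⟩, h2⟩

/-- The rescaled probability that a watermelon passes at time `k` through the heights
`k + 2 * z i`. -/
noncomputable def passWeight (p n k : ℕ) (z : Fin p → ℤ) : ℝ :=
  (√(2 * n) / 2) ^ p * (Nat.card {w : Fin p → ℕ → ℤ // IsMelonW p n w ∧ ∀ i, w i k = k + 2 * z i} /
    Nat.card {w : Fin p → ℕ → ℤ // IsMelonW p n w})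

/-- The half-heights at time `k` allowed by the box with corners `a` and `b`. -/
noncomputable def latticeBox {p : ℕ} (k : ℕ) (a b : Fin p → ℝ) : Finset (Fin p → ℤ) :=
  Fintype.piFinset fun i => Finset.Icc ⌈(a i - k) / 2⌉ ⌊(b i - k) / 2⌋

theorem mem_latticeBox {p : ℕ} {k : ℕ} {a b : Fin p → ℝ} {z : Fin p → ℤ} :
    z ∈ latticeBox k a b ↔ ∀ i, a i ≤ k + 2 * z i ∧ (k : ℝ) + 2 * z i ≤ b i := by
  simp only [latticeBox, Fintype.mem_piFinset, Finset.mem_Icc, Int.ceil_le, Int.le_floor]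
  refine forall_congr' fun i => and_congr ⟨fun h => ?_, fun h => ?_⟩ ⟨fun h => ?_, fun h => ?_⟩ <;>
    linarith

theorem probW_eq_sum {p n k : ℕ} (hn : 0 < n) (hk : k ≤ 2 * n) (a b : Fin p → ℝ) :
    probW p n (fun w => ∀ i, a i ≤ (w i k : ℝ) ∧ (w i k : ℝ) ≤ b i) =
      ∑ z ∈ latticeBox k a b, passWeight p n k z * (2 / √(2 * n)) ^ p := by
  have hfin : Finite {w : Fin p → ℕ → ℤ // IsMelonW p n w} := StarTo.finite p (2 * n) _
  have hpar : ∀ w, IsMelonW p n w → ∀ i, w i k = k + 2 * ((w i k - k) / 2) := fun w hw i => by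
    have := hw.1.dvd_sub i hk
    omega
  rw [probW, card_subtype_and_eq_sum_fiber hfin (fun w i => (w i k - k) / 2) (latticeBox k a b)]
  · have hs : √(2 * (n : ℝ)) ≠ 0 := by positivity
    rw [Nat.cast_sum, Finset.sum_div]
    refine Finset.sum_congr rfl fun z _ => ?_
    have hcard : Nat.card {w : Fin p → ℕ → ℤ // IsMelonW p n w ∧ (fun i => (w i k - k) / 2) = z} =
        Nat.card {w : Fin p → ℕ → ℤ // IsMelonW p n w ∧ ∀ i, w i k = k + 2 * z i} := by
      refine Nat.card_congr (Equiv.subtypeEquivRight fun w => and_congr_right fun hw => ?_)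
      rw [funext_iff]
      refine forall_congr' fun i => ?_
      have := hpar w hw i
      omega
    rw [hcard, passWeight, mul_right_comm, ← mul_pow, div_mul_div_comm, mul_comm (√_) 2, div_self,
      one_pow, one_mul]
    positivity
  · intro w hw
    rw [mem_latticeBox]
    refine forall_congr' fun i => ?_
    have h : (w i k : ℝ) = k + 2 * ((w i k - k) / 2 : ℤ) := by exact_mod_cast hpar w hw i
    rw [← h]

/-- The index of the lattice cell containing `y`. -/
noncomputable def cellIndex {p : ℕ} (r : ℝ) (k : ℕ) (y : Fin p → ℝ) : Fin p → ℤ :=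
  fun i => ⌊(y i * r - k) / 2⌋

theorem cellIndex_eq_iff {p : ℕ} {r : ℝ} (hr : 0 < r) {k : ℕ} {y : Fin p → ℝ} {z : Fin p → ℤ} :
    cellIndex r k y = z ↔ y ∈ Set.univ.pi fun i =>
      Set.Ico ((k + 2 * z i) / r) ((k + 2 * z i + 2) / r) := by
  simp only [funext_iff, cellIndex, Int.floor_eq_iff, Set.mem_pi, Set.mem_univ, forall_true_left,
    Set.mem_Ico, div_le_iff₀ hr, lt_div_iff₀ hr]
  refine forall_congr' fun i => and_congr ⟨fun h => ?_, fun h => ?_⟩ ⟨fun h => ?_, fun h => ?_⟩ <;>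
    linarith

theorem measurable_cellIndex {p : ℕ} (r : ℝ) (k : ℕ) :
    Measurable (cellIndex (p := p) r k) := by
  refine measurable_pi_lambda _ fun i => ?_
  exact Int.measurable_floor.comp (by fun_prop)

open Classical in
theorem integral_cellIndex {p : ℕ} {r : ℝ} (hr : 0 < r) (k : ℕ) (E : Finset (Fin p → ℤ))
    (g : (Fin p → ℤ) → ℝ) :
    ∫ y, (if cellIndex r k y ∈ E then g (cellIndex r k y) else 0) =
      ∑ z ∈ E, g z * (2 / r) ^ p := by
  let S : (Fin p → ℤ) → Set (Fin p → ℝ) := fun z =>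
    Set.univ.pi fun i => Set.Ico ((k + 2 * z i) / r) ((k + 2 * z i + 2) / r)
  have hvol : ∀ z, volume (S z) = ENNReal.ofReal ((2 / r) ^ p) := fun z => by
    simp only [S, Real.volume_pi_Ico]
    rw [ENNReal.ofReal_pow (by positivity)]
    simp only [add_div, add_sub_cancel_left, Finset.prod_const, Finset.card_univ, Fintype.card_fin]
  have hmeas : ∀ z, MeasurableSet (S z) := fun z =>
    MeasurableSet.univ_pi fun i => measurableSet_Ico
  have hfun : (fun y => if cellIndex r k y ∈ E then g (cellIndex r k y) else 0) =
      fun y => ∑ z ∈ E, (S z).indicator (fun _ => g z) y := by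
    funext y
    simp only [Set.indicator_apply, S, ← cellIndex_eq_iff hr]
    rw [Finset.sum_ite_eq]
  rw [hfun, integral_finsetSum]
  · refine Finset.sum_congr rfl fun z _ => ?_
    rw [integral_indicator_const _ (hmeas z), Measure.real, hvol,
      ENNReal.toReal_ofReal (by positivity), smul_eq_mul, mul_comm]
  · intro z _
    refine (integrable_indicator_iff (hmeas z)).mpr (integrableOn_const ?_)
    rw [hvol]; exact ENNReal.ofReal_ne_top

/-- The factor of the number of stars that does not depend on the end points. -/
noncomputable def starConst (p m : ℕ) : ℝ :=
  ∏ i : Fin p, ((m + 2 * i).factorial : ℝ) / (m + 2 * p - 1).factorial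

/-- The factor of the number of watermelons that does not depend on their length. -/
noncomputable def melonConst (p : ℕ) : ℝ :=
  (∏ i : Fin p, (2 * ((i : ℕ) : ℝ) + 1)) *
    ∏ i : Fin p, ∏ j ∈ Finset.Ioi i, ((((j : ℕ) : ℝ) - ((i : ℕ) : ℝ)) *
      (((j : ℕ) : ℝ) + ((i : ℕ) : ℝ) + 1))

/-- A binomial coefficient rescaled as in the local central limit theorem. -/
noncomputable def scaledChoose (M : ℝ) (R c : ℕ) : ℝ := (R.choose c : ℝ) * √M / 2 ^ R

/-- The factor of `passWeight` that does not depend on the heights. -/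
noncomputable def passConst (p n k : ℕ) : ℝ :=
  (2 * n) ^ (p ^ 2) * (starConst p k * starConst p (2 * n - k) / starConst p (2 * n)) /
    (melonConst p * ∏ i : Fin p, scaledChoose (2 * n) (2 * n + 2 * p - 1) (n + 1 + i + (p - 1)))

/-- The closed form of `passWeight` for strictly increasing heights. -/
noncomputable def passFormula (p n k : ℕ) (z : Fin p → ℤ) : ℝ :=
  (∏ i : Fin p, scaledChoose (2 * n) (k + 2 * p - 1) ((k + 1 + z i).toNat + (p - 1)) *
    scaledChoose (2 * n) (2 * n - k + 2 * p - 1) ((n + 1 + z i).toNat + (p - 1)) *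
      ((k + 2 * z i + 1) / √(2 * n)) ^ 2) *
  (∏ i : Fin p, ∏ j ∈ Finset.Ioi i,
    (((k + 2 * z j + 1 : ℝ) ^ 2 - (k + 2 * z i + 1) ^ 2) / (2 * n)) ^ 2) * passConst p n k

theorem card_starTo_heights {p m : ℕ} (a : Fin p → ℤ) (h0 : ∀ i, (m : ℤ) + 2 ≤ 2 * a i)
    (h1 : ∀ i, a i ≤ m + 1) (hmono : StrictMono a) :
    (Nat.card (StarTo p m fun i => 2 * a i - m - 2) : ℝ) =
      starConst p m *
      (∏ i : Fin p, (2 * (a i : ℝ) - m - 1) * (m + 2 * p - 1).choose ((a i).toNat + (p - 1))) *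
      ∏ i : Fin p, ∏ j ∈ Finset.Ioi i,
        ((2 * (a j : ℝ) - m - 1) ^ 2 - (2 * (a i : ℝ) - m - 1) ^ 2) / 4 := by
  have h := card_starTo_eq_prod (p := p) (m := m) (fun i => (a i).toNat)
    (fun i => ((m : ℤ) + 1 - a i).toNat)
    (fun i => by have := h0 i; have := h1 i; omega)
    (fun i => by have := h0 i; have := h1 i; omega)
    (fun i j hij => by
      have := hmono hij; have := h0 i; have := h1 i; have := h0 j; have := h1 j
      dsimp only; omega)
  have e1 : ∀ i, (((a i).toNat : ℕ) : ℤ) - (((m : ℤ) + 1 - a i).toNat : ℕ) = 2 * a i - m - 1 :=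
    fun i => by have := h0 i; have := h1 i; omega
  have e2 : ∀ i, (((a i).toNat : ℕ) : ℝ) - (((m : ℤ) + 1 - a i).toNat : ℕ) =
      2 * (a i : ℝ) - m - 1 := fun i => by exact_mod_cast e1 i
  have e3 : ∀ i, (((a i).toNat : ℕ) : ℤ) - (((m : ℤ) + 1 - a i).toNat : ℕ) - 1 = 2 * a i - m - 2 :=
    fun i => by rw [e1]; ring
  simp only [e2, e3] at h
  exact h

theorem sum_card_Ioi (p : ℕ) : 2 * (∑ i : Fin p, (Finset.Ioi i).card) + p = p ^ 2 := by
  have h : ∑ i : Fin p, (Finset.Ioi i).card = ∑ i ∈ Finset.range p, i := by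
    simp only [Fin.card_Ioi]
    rw [Fin.sum_univ_eq_sum_range (fun i => p - 1 - i), Finset.sum_range_reflect fun i => i]
  rw [h, mul_comm, Finset.sum_range_id_mul_two]
  cases p <;> simp
  ring

theorem prod_Ioi_div {p : ℕ} (f : Fin p → Fin p → ℝ) (c : ℝ) :
    ∏ i : Fin p, ∏ j ∈ Finset.Ioi i, f i j / c =
      (∏ i : Fin p, ∏ j ∈ Finset.Ioi i, f i j) / c ^ (∑ i : Fin p, (Finset.Ioi i).card) := by
  simp only [Finset.prod_div_distrib, Finset.prod_const, Finset.prod_pow_eq_pow_sum]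

theorem passWeight_eq_passFormula {p n k : ℕ} (hp : 1 ≤ p) (hpn : p ≤ n) (hk : k ≤ 2 * n)
    {z : Fin p → ℤ} (hz : ∀ i, 0 ≤ (k : ℤ) + 2 * z i) (hz1 : ∀ i, (k : ℤ) + 2 * z i ≤ k)
    (hz2 : ∀ i, (k : ℤ) + 2 * z i ≤ 2 * n - k) (hmono : StrictMono z) :
    passWeight p n k z = passFormula p n k z := by
  have hsub : ((2 * n - k : ℕ) : ℤ) = 2 * n - k := by push_cast [hk]; ring
  have hsubr : ((2 * n - k : ℕ) : ℝ) = 2 * n - k := by push_cast [hk]; ring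
  have h1 := card_starTo_heights (m := k) (fun i => k + 1 + z i)
    (fun i => by have := hz i; omega) (fun i => by have := hz1 i; omega)
    (fun i j hij => by have := hmono hij; dsimp only; omega)
  have h2 := card_starTo_heights (m := 2 * n - k) (fun i => n + 1 + z i)
    (fun i => by have := hz i; omega) (fun i => by have := hz2 i; omega)
    (fun i j hij => by have := hmono hij; dsimp only; omega)
  have h3 := card_starTo_heights (p := p) (m := 2 * n) (fun i => ((n + 1 + i : ℕ) : ℤ))
    (fun i => by push_cast; omega) (fun i => by have := i.2; push_cast; omega)
    (fun i j hij => by have : (i : ℕ) < j := hij; dsimp only; omega)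
  have e1 : (fun i => 2 * ((k : ℤ) + 1 + z i) - k - 2) = fun i => (k : ℤ) + 2 * z i := by
    funext i; ring
  have e2 : (fun i => 2 * ((n : ℤ) + 1 + z i) - (2 * n - k : ℕ) - 2) =
      fun i => (k : ℤ) + 2 * z i := by
    funext i; rw [hsub]; ring
  have e3 : (fun i : Fin p => 2 * ((n + 1 + i : ℕ) : ℤ) - (2 * n : ℕ) - 2) =
      fun i : Fin p => 2 * ((i : ℕ) : ℤ) := by
    funext i; push_cast; ring
  have f1 : ∀ i, 2 * (((k : ℤ) + 1 + z i : ℤ) : ℝ) - k - 1 = k + 2 * z i + 1 := fun i => by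
    push_cast; ring
  have f2 : ∀ i, 2 * (((n : ℤ) + 1 + z i : ℤ) : ℝ) - (2 * n - k : ℕ) - 1 = k + 2 * z i + 1 :=
    fun i => by rw [hsubr]; push_cast; ring
  have f3 : ∀ i : Fin p, 2 * (((n + 1 + i : ℕ) : ℤ) : ℝ) - (2 * n : ℕ) - 1 =
      2 * ((i : ℕ) : ℝ) + 1 := fun i => by push_cast; ring
  have f4 : ∀ i j : Fin p, ((2 * ((j : ℕ) : ℝ) + 1) ^ 2 - (2 * ((i : ℕ) : ℝ) + 1) ^ 2) / 4 =
      (((j : ℕ) : ℝ) - ((i : ℕ) : ℝ)) * (((j : ℕ) : ℝ) + ((i : ℕ) : ℝ) + 1) := fun i j => by ring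
  rw [e1] at h1
  rw [e2] at h2
  rw [e3] at h3
  simp only [f1] at h1
  simp only [f2] at h2
  simp only [f3, f4, Int.toNat_natCast] at h3
  have hcut := card_melon_at hk (fun i => (k : ℤ) + 2 * z i)
  rw [passWeight, hcut, card_melon, Nat.cast_mul, h1, h2, h3, passFormula, passConst, melonConst]
  simp only [scaledChoose, Finset.prod_pow, prod_Ioi_div]
  simp only [ Finset.prod_mul_distrib, Finset.prod_div_distrib,
    Finset.prod_pow, div_pow, Finset.prod_const, Finset.card_univ, Fintype.card_fin]
  have hn : (0 : ℝ) < n := by exact_mod_cast (show 0 < n by omega)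
  have hN := sum_card_Ioi p
  set N := ∑ i : Fin p, (Finset.Ioi i).card
  have hA : ((2 : ℝ) ^ p) ^ (k + 2 * p - 1) * ((2 : ℝ) ^ p) ^ (2 * n - k + 2 * p - 1) =
      ((2 : ℝ) ^ p) ^ (2 * n + 2 * p - 1) * (2 ^ p * (4 ^ N) ^ 2) := by
    rw [show (4 : ℝ) = 2 ^ 2 by norm_num]
    simp only [← pow_mul, ← pow_add]
    congr 1
    zify [show 1 ≤ k + 2 * p by omega, show 1 ≤ 2 * n - k + 2 * p by omega, hk,
      show 1 ≤ 2 * n + 2 * p by omega] at hN ⊢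
    linear_combination (-2) * hN
  have hm : (2 * (n : ℝ)) ^ (p ^ 2) = ((2 * (n : ℝ)) ^ N) ^ 2 * (√(2 * (n : ℝ)) ^ p) ^ 2 := by
    rw [← pow_mul, ← pow_mul, mul_comm p 2, pow_mul _ 2 p, Real.sq_sqrt (by positivity), ← pow_add]
    congr 1; omega
  have hρ : √(2 * (n : ℝ)) ^ p ≠ 0 := by positivity
  have hμ : (2 * (n : ℝ)) ^ N ≠ 0 := by positivity
  rw [hm]
  generalize √(2 * (n : ℝ)) ^ p = ρ at *
  generalize (2 * (n : ℝ)) ^ N = μ at *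
  have hF : (4 : ℝ) ^ N ≠ 0 := by positivity
  have hT : (2 : ℝ) ^ p ≠ 0 := by positivity
  have hA0 : ((2 : ℝ) ^ p) ^ (2 * n + 2 * p - 1) ≠ 0 := by positivity
  have hA1 : ((2 : ℝ) ^ p) ^ (k + 2 * p - 1) ≠ 0 := by positivity
  have hA2 : ((2 : ℝ) ^ p) ^ (2 * n - k + 2 * p - 1) ≠ 0 := by positivity
  generalize ((2 : ℝ) ^ p) ^ (2 * n + 2 * p - 1) = A0 at *
  generalize ((2 : ℝ) ^ p) ^ (k + 2 * p - 1) = A1 at *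
  generalize ((2 : ℝ) ^ p) ^ (2 * n - k + 2 * p - 1) = A2 at *
  generalize (4 : ℝ) ^ N = F at *
  generalize (2 : ℝ) ^ p = T at *
  generalize hX : ∏ i, ((k : ℝ) + 2 * z i + 1) = X
  generalize hC1 : ∏ i, ((k + 2 * p - 1).choose ((k + 1 + z i).toNat + (p - 1)) : ℝ) = C1
  generalize hC2 : ∏ i, ((2 * n - k + 2 * p - 1).choose ((n + 1 + z i).toNat + (p - 1)) : ℝ) = C2
  rw [← eq_div_iff hA2] at hA
  subst hA
  clear * - hρ hμ hF hT hA0 hA2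
  field_simp

theorem tendsto_pow_mul_starConst (p : ℕ) :
    Tendsto (fun m : ℕ => (m : ℝ) ^ (p ^ 2) * starConst p m) atTop (nhds 1) := by
  have hsum : ∑ i : Fin p, (2 * p - 1 - 2 * (i : ℕ)) = p ^ 2 := by
    have hN := sum_card_Ioi p
    simp only [Fin.card_Ioi] at hN
    have hone : ∑ _i : Fin p, 1 = p := by simp
    rw [← hN, Finset.mul_sum]
    refine Eq.trans ?_ (congrArg (_ + ·) hone)
    rw [← Finset.sum_add_distrib]
    exact Finset.sum_congr rfl fun i _ => by have := i.2; omega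
  have h : Tendsto (fun m : ℕ => ∏ i : Fin p, (m : ℝ) ^ (2 * p - 1 - 2 * (i : ℕ)) *
      (((m + 2 * i).factorial : ℝ) /
        ((m + (2 * (i : ℕ) + (2 * p - 1 - 2 * (i : ℕ)))).factorial : ℝ))) atTop
      (nhds (∏ _i : Fin p, 1)) :=
    tendsto_finsetProd _ fun i _ => tendsto_pow_mul_factorial_div _ _
  rw [Finset.prod_const_one] at h
  refine h.congr fun m => ?_
  rw [Finset.prod_mul_distrib, Finset.prod_pow_eq_pow_sum, hsum, starConst]
  congr 1
  refine Finset.prod_congr rfl fun i _ => ?_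
  have := i.2
  rw [show m + (2 * (i : ℕ) + (2 * p - 1 - 2 * (i : ℕ))) = m + 2 * p - 1 by omega]

theorem melonConst_pos (p : ℕ) : 0 < melonConst p := by
  refine mul_pos (Finset.prod_pos fun i _ => by positivity)
    (Finset.prod_pos fun i _ => Finset.prod_pos fun j hj => ?_)
  have h : ((i : ℕ) : ℝ) < (j : ℕ) := by exact_mod_cast Finset.mem_Ioi.mp hj
  exact mul_pos (sub_pos.mpr h) (by positivity)

theorem tendsto_scaledChoose {c R : ℕ → ℕ} {M : ℕ → ℝ} {y τ : ℝ} (hτ : 0 < τ)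
    (hM : Tendsto M atTop atTop) (hcR : ∀ᶠ n in atTop, c n ≤ R n)
    (hR : Tendsto (fun n => (R n : ℝ) / M n) atTop (nhds τ))
    (hy : Tendsto (fun n => (2 * (c n : ℝ) - R n) / √(M n)) atTop (nhds y)) :
    Tendsto (fun n => scaledChoose (M n) (R n) (c n)) atTop
      (nhds (√(2 / Real.pi) / √τ * Real.exp (-(y ^ 2 / (2 * τ))))) := by
  have h := tendsto_choose_mul_sqrt_scaled (a := c) (b := fun n => R n - c n) (y := y) hτ hM
    (hR.congr' (by filter_upwards [hcR] with n hn; push_cast [hn]; ring))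
    (hy.congr' (by filter_upwards [hcR] with n hn; push_cast [hn]; ring))
  refine h.congr' ?_
  filter_upwards [hcR] with n hn
  rw [scaledChoose, Nat.add_sub_cancel' hn]

theorem tendsto_two_mul_natCast_atTop : Tendsto (fun n : ℕ => 2 * (n : ℝ)) atTop atTop :=
  tendsto_natCast_atTop_atTop.const_mul_atTop two_pos

theorem tendsto_const_div_sqrt (B : ℝ) :
    Tendsto (fun n : ℕ => B / √(2 * (n : ℝ))) atTop (nhds 0) :=
  (Real.tendsto_sqrt_atTop.comp tendsto_two_mul_natCast_atTop).const_div_atTop B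

theorem eventually_mul_sqrt_le {c : ℕ → ℕ} {τ : ℝ} (hτ : 0 < τ)
    (hc : Tendsto (fun n => (c n : ℝ) / (2 * n)) atTop (nhds τ)) (B : ℝ) :
    ∀ᶠ n : ℕ in atTop, B * √(2 * (n : ℝ)) ≤ c n := by
  filter_upwards [(tendsto_const_div_sqrt B).eventually_lt hc hτ, eventually_gt_atTop 0] with n h hn
  have hm : (0 : ℝ) < 2 * n := by positivity
  rw [lt_div_iff₀ hm] at h
  nth_rw 2 [← Real.sq_sqrt hm.le] at h
  have hs : 0 < √(2 * (n : ℝ)) := by positivity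
  calc B * √(2 * (n : ℝ)) = B / √(2 * (n : ℝ)) * √(2 * (n : ℝ)) ^ 2 := by field_simp
    _ ≤ c n := h.le

theorem tendsto_natCast_of_ratio {c : ℕ → ℕ} {τ : ℝ} (hτ : 0 < τ)
    (hc : Tendsto (fun n => (c n : ℝ) / (2 * n)) atTop (nhds τ)) : Tendsto c atTop atTop := by
  rw [← tendsto_natCast_atTop_iff (R := ℝ)]
  refine tendsto_atTop_mono' _ (eventually_mul_sqrt_le hτ hc 1) ?_
  exact (Real.tendsto_sqrt_atTop.comp tendsto_two_mul_natCast_atTop).congr fun n => (one_mul _).symm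

theorem tendsto_add_ratio {c : ℕ → ℕ} {τ : ℝ} (p : ℕ)
    (hc : Tendsto (fun n => (c n : ℝ) / (2 * n)) atTop (nhds τ)) :
    Tendsto (fun n : ℕ => ((c n + 2 * p - 1 : ℕ) : ℝ) / (2 * n)) atTop (nhds τ) := by
  have h2 : Tendsto (fun n : ℕ => (2 * p : ℝ) / (2 * n)) atTop (nhds 0) :=
    tendsto_two_mul_natCast_atTop.const_div_atTop _
  have h1 : Tendsto (fun n : ℕ => (1 : ℝ) / (2 * n)) atTop (nhds 0) :=
    tendsto_two_mul_natCast_atTop.const_div_atTop _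
  refine tendsto_of_tendsto_of_tendsto_of_le_of_le (g := fun n => (c n : ℝ) / (2 * n) - 1 / (2 * n))
    (h := fun n => (c n : ℝ) / (2 * n) + (2 * p) / (2 * n)) (by simpa using hc.sub h1)
    (by simpa using hc.add h2) (fun n => ?_) (fun n => ?_)
  · simp only
    rw [← sub_div]
    gcongr
    have : c n ≤ c n + 2 * p - 1 + 1 := by omega
    have : (c n : ℝ) ≤ (c n + 2 * p - 1 : ℕ) + 1 := by exact_mod_cast this
    linarith
  · simp only
    rw [← add_div]
    gcongr
    have : c n + 2 * p - 1 ≤ c n + 2 * p := by omega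
    exact_mod_cast this

theorem tendsto_ratio_compl {k : ℕ → ℕ} {t : ℝ} (hk : ∀ n, k n ≤ 2 * n)
    (hkt : Tendsto (fun n => (k n : ℝ) / (2 * n)) atTop (nhds t)) :
    Tendsto (fun n => ((2 * n - k n : ℕ) : ℝ) / (2 * n)) atTop (nhds (1 - t)) := by
  refine (hkt.const_sub 1).congr' ?_
  filter_upwards [eventually_gt_atTop 0] with n hn
  push_cast [hk n]
  field_simp

/-- The limit of `passConst`. -/
noncomputable def passConstLimit (p : ℕ) (t : ℝ) : ℝ :=
  ((t * (1 - t)) ^ (p ^ 2))⁻¹ / (melonConst p * √(2 / Real.pi) ^ p)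

theorem tendsto_passConst {p : ℕ} {k : ℕ → ℕ} {t : ℝ} (ht0 : 0 < t) (ht1 : t < 1)
    (hk : ∀ n, k n ≤ 2 * n) (hkt : Tendsto (fun n => (k n : ℝ) / (2 * n)) atTop (nhds t)) :
    Tendsto (fun n => passConst p n (k n)) atTop (nhds (passConstLimit p t)) := by
  have hkt' := tendsto_ratio_compl hk hkt
  have ht1' : 0 < 1 - t := by linarith
  have hkinf := tendsto_natCast_of_ratio ht0 hkt
  have hkinf' := tendsto_natCast_of_ratio ht1' hkt'
  have h2inf : Tendsto (fun n : ℕ => 2 * n) atTop atTop :=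
    tendsto_id.const_mul_atTop' two_pos
  have hD := tendsto_pow_mul_starConst p
  have hone : Tendsto (fun n : ℕ => ((2 * n : ℕ) : ℝ) / (2 * n)) atTop (nhds 1) := by
    refine tendsto_const_nhds.congr' ?_
    filter_upwards [eventually_gt_atTop 0] with n hn
    push_cast
    field_simp
  have hS := (((hD.comp hkinf).mul (hD.comp hkinf')).div (hD.comp h2inf) one_ne_zero).mul
    (((hkt.mul hkt').pow (p ^ 2)).inv₀ (pow_ne_zero _ (mul_pos ht0 ht1').ne'))
  have hC : Tendsto (fun n : ℕ => ∏ i : Fin p,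
      scaledChoose (2 * n) (2 * n + 2 * p - 1) (n + 1 + i + (p - 1))) atTop
      (nhds (∏ _i : Fin p, √(2 / Real.pi))) := by
    refine tendsto_finsetProd _ fun i _ => ?_
    have h := tendsto_scaledChoose (c := fun n => n + 1 + i + (p - 1))
      (R := fun n => 2 * n + 2 * p - 1) (y := 0) one_pos tendsto_two_mul_natCast_atTop
      ?_ (tendsto_add_ratio p hone) ?_
    · simpa using h
    · filter_upwards [eventually_ge_atTop p] with n hn
      have := i.2
      omega
    · refine (tendsto_const_div_sqrt (2 * (i : ℕ) + 1)).congr fun n => ?_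
      have := i.2
      have h : 2 * ((n + 1 + i + (p - 1) : ℕ) : ℤ) - ((2 * n + 2 * p - 1 : ℕ) : ℤ) =
          2 * (i : ℕ) + 1 := by omega
      have h' : 2 * ((n + 1 + i + (p - 1) : ℕ) : ℝ) - ((2 * n + 2 * p - 1 : ℕ) : ℝ) =
          2 * (i : ℕ) + 1 := by exact_mod_cast h
      rw [h']
  rw [Finset.prod_const, Finset.card_univ, Fintype.card_fin] at hC
  have hden := hC.const_mul (melonConst p)
  have h := hS.div hden (mul_pos (melonConst_pos p) (by positivity)).ne'
  rw [one_mul, div_one, one_mul] at h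
  refine h.congr' ?_
  filter_upwards [eventually_gt_atTop 0, hkinf.eventually_gt_atTop 0,
    hkinf'.eventually_gt_atTop 0] with n hn h1 h2
  simp only [Pi.div_apply, Function.comp_apply, passConst]
  congr 1
  have h1' : (0 : ℝ) < k n := by exact_mod_cast h1
  have h2' : (0 : ℝ) < (2 * n - k n : ℕ) := by exact_mod_cast h2
  rw [Nat.cast_mul 2 n, Nat.cast_ofNat]
  have hn' : (0 : ℝ) < 2 * n := by positivity
  generalize (2 * (n : ℝ)) = m at *
  simp only [mul_pow, div_pow]
  field_simp

/-- The density of the limit, in the product form in which it arises from `passFormula`. -/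
noncomputable def limitDensity (p : ℕ) (t : ℝ) (y : Fin p → ℝ) : ℝ :=
  (∏ i : Fin p, √(2 / Real.pi) / √t * Real.exp (-(y i ^ 2 / (2 * t))) *
    (√(2 / Real.pi) / √(1 - t) * Real.exp (-(y i ^ 2 / (2 * (1 - t))))) * y i ^ 2) *
  (∏ i : Fin p, ∏ j ∈ Finset.Ioi i, (y j ^ 2 - y i ^ 2) ^ 2) * passConstLimit p t

theorem factorial_two_mul_eq (p : ℕ) :
    ((2 * p).factorial : ℝ) = 2 ^ p * p.factorial * ∏ i : Fin p, (2 * ((i : ℕ) : ℝ) + 1) := by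
  rw [Fin.prod_univ_eq_prod_range fun i : ℕ => 2 * (i : ℝ) + 1]
  induction p with
  | zero => simp
  | succ p ih =>
    rw [show 2 * (p + 1) = 2 * p + 1 + 1 by ring, Nat.factorial_succ, Nat.factorial_succ,
      Nat.factorial_succ, Finset.prod_range_succ]
    push_cast
    rw [ih]
    ring

theorem rpow_half_eq_sqrt_pow {x : ℝ} (hx : 0 ≤ x) (p : ℕ) : x ^ ((p : ℝ) / 2) = √x ^ p := by
  rw [Real.sqrt_eq_rpow, ← Real.rpow_natCast, ← Real.rpow_mul hx]
  congr 1; ring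

theorem cW_eq (p : ℕ) : cW p = √(2 / Real.pi) ^ p / melonConst p := by
  have h2 : (2 : ℝ) ^ ((3 * (p : ℝ)) / 2) = 2 ^ p * √2 ^ p := by
    rw [Real.sqrt_eq_rpow, ← Real.rpow_natCast, ← Real.rpow_natCast,
      ← Real.rpow_mul zero_le_two, ← Real.rpow_add two_pos]
    congr 1; ring
  have hf : (p.factorial : ℝ) ≠ 0 := by positivity
  have hm := melonConst_pos p
  rw [melonConst] at hm
  rw [cW, h2, rpow_half_eq_sqrt_pow Real.pi_pos.le, factorial_two_mul_eq, melonConst,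
    Real.sqrt_div zero_le_two, div_pow]
  have hs : √Real.pi ≠ 0 := by positivity
  have hA := left_ne_zero_of_mul hm.ne'
  have hB := right_ne_zero_of_mul hm.ne'
  generalize (∏ i : Fin p, (2 * ((i : ℕ) : ℝ) + 1)) = A at *
  generalize (∏ i : Fin p, ∏ j ∈ Finset.Ioi i, ((((j : ℕ) : ℝ) - ((i : ℕ) : ℝ)) *
      (((j : ℕ) : ℝ) + ((i : ℕ) : ℝ) + 1))) = B at *
  field_simp

theorem limitDensity_eq {p : ℕ} {t : ℝ} (ht0 : 0 < t) (ht1 : t < 1) (y : Fin p → ℝ) :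
    limitDensity p t y = cW p * (t * (1 - t)) ^ (-(((p : ℝ) ^ 2) + (p : ℝ) / 2)) *
      (∏ i : Fin p, ∏ j ∈ Finset.Ioi i, ((y j) ^ 2 - (y i) ^ 2) ^ 2) *
      (∏ i : Fin p, (y i) ^ 2) * Real.exp (-(∑ i, (y i) ^ 2) / (2 * t * (1 - t))) := by
  have ht1' : 0 < 1 - t := by linarith
  have hT : 0 < t * (1 - t) := by positivity
  have hexp : (∏ i, Real.exp (-(y i ^ 2 / (2 * t)))) * ∏ i, Real.exp (-(y i ^ 2 / (2 * (1 - t)))) =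
      Real.exp (-(∑ i, (y i) ^ 2) / (2 * t * (1 - t))) := by
    rw [← Finset.prod_mul_distrib, neg_div, Finset.sum_div, ← Finset.sum_neg_distrib, Real.exp_sum]
    refine Finset.prod_congr rfl fun i _ => ?_
    rw [← Real.exp_add]
    congr 1
    field_simp
    ring
  have hpow : (t * (1 - t)) ^ (-(((p : ℝ) ^ 2) + (p : ℝ) / 2)) =
      ((t * (1 - t)) ^ (p ^ 2))⁻¹ * ((√t ^ p)⁻¹ * (√(1 - t) ^ p)⁻¹) := by
    rw [← mul_inv, ← mul_pow, ← Real.sqrt_mul ht0.le, ← mul_inv, Real.rpow_neg hT.le,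
      Real.rpow_add hT, rpow_half_eq_sqrt_pow hT.le, ← Real.rpow_natCast _ (p ^ 2), Nat.cast_pow]
  rw [hpow, ← hexp, cW_eq, limitDensity, passConstLimit]
  simp only [Finset.prod_mul_distrib, Finset.prod_const, Finset.card_univ, Fintype.card_fin,
    div_pow]
  have hs : √(2 / Real.pi) ≠ 0 := by positivity
  have := (melonConst_pos p).ne'
  have := hT.ne'
  generalize ∏ i : Fin p, ∏ j ∈ Finset.Ioi i, (y j ^ 2 - y i ^ 2) ^ 2 = V
  generalize (t * (1 - t)) ^ p ^ 2 = K
  field_simp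

theorem limitDensity_eq_zero {p : ℕ} {t : ℝ} {y : Fin p → ℝ} {i j : Fin p} (hij : i < j)
    (h : y i = y j) : limitDensity p t y = 0 := by
  rw [limitDensity, Finset.prod_eq_zero (s := Finset.univ)
    (f := fun i => ∏ j ∈ Finset.Ioi i, (y j ^ 2 - y i ^ 2) ^ 2)
    (Finset.mem_univ i), mul_zero, zero_mul]
  exact Finset.prod_eq_zero (Finset.mem_Ioi.mpr hij) (by rw [h]; ring)

theorem tendsto_passFormula {p : ℕ} {k : ℕ → ℕ} {t : ℝ} (ht0 : 0 < t) (ht1 : t < 1)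
    (hk : ∀ n, k n ≤ 2 * n) (hkt : Tendsto (fun n => (k n : ℝ) / (2 * n)) atTop (nhds t))
    {z : ℕ → Fin p → ℤ} {y : Fin p → ℝ} (hy : ∀ i, 0 < y i)
    (hz : ∀ i, Tendsto (fun n => ((k n : ℝ) + 2 * z n i + 1) / √(2 * n)) atTop (nhds (y i))) :
    Tendsto (fun n => passFormula p n (k n) (z n)) atTop (nhds (limitDensity p t y)) := by
  have hkt' := tendsto_ratio_compl hk hkt
  have ht1' : 0 < 1 - t := by linarith
  have hrange : ∀ i, ∀ᶠ n in atTop, 0 < (k n : ℤ) + 2 * z n i + 1 ∧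
      (k n : ℤ) + 2 * z n i + 1 ≤ k n ∧ (k n : ℤ) + 2 * z n i + 1 ≤ 2 * n - k n := fun i => by
    filter_upwards [(hz i).eventually_const_lt (hy i),
      (hz i).eventually_lt_const (lt_add_one (y i)), eventually_mul_sqrt_le ht0 hkt (y i + 1),
      eventually_mul_sqrt_le ht1' hkt' (y i + 1), eventually_gt_atTop 0] with n h1 h2 h3 h4 hn
    have hs : 0 < √(2 * (n : ℝ)) := by positivity
    rw [lt_div_iff₀ hs, zero_mul] at h1
    rw [div_lt_iff₀ hs] at h2
    push_cast [hk n] at h4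
    refine ⟨by exact_mod_cast h1, ?_, ?_⟩
    · have : ((k n : ℝ) + 2 * z n i + 1) ≤ k n := h2.le.trans h3
      exact_mod_cast this
    · have : ((k n : ℝ) + 2 * z n i + 1) ≤ 2 * n - k n := h2.le.trans h4
      exact_mod_cast this
  refine ((tendsto_finsetProd _ fun i _ => ?_).mul
    (tendsto_finsetProd _ fun i _ => tendsto_finsetProd _ fun j _ => ?_)).mul
    (tendsto_passConst ht0 ht1 hk hkt)
  · refine (Tendsto.mul ?_ ?_).mul ((hz i).pow 2)
    · refine tendsto_scaledChoose ht0 tendsto_two_mul_natCast_atTop ?_ (tendsto_add_ratio p hkt) ?_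
      · filter_upwards [hrange i] with n hn
        have := i.2
        omega
      · refine (hz i).congr' ?_
        filter_upwards [hrange i] with n hn
        have := i.2
        have h : (k n : ℤ) + 2 * z n i + 1 = 2 * (((k n + 1 + z n i).toNat + (p - 1) : ℕ) : ℤ) -
          ((k n + 2 * p - 1 : ℕ) : ℤ) := by omega
        congr 1
        exact_mod_cast congrArg (Int.cast (R := ℝ)) h
    · refine tendsto_scaledChoose ht1' tendsto_two_mul_natCast_atTop ?_
        (tendsto_add_ratio p hkt') ?_
      · filter_upwards [hrange i] with n hn
        have := i.2
        have := hk n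
        omega
      · refine (hz i).congr' ?_
        filter_upwards [hrange i] with n hn
        have := i.2
        have := hk n
        have h : (k n : ℤ) + 2 * z n i + 1 = 2 * (((n + 1 + z n i).toNat + (p - 1) : ℕ) : ℤ) -
          ((2 * n - k n + 2 * p - 1 : ℕ) : ℤ) := by omega
        congr 1
        exact_mod_cast congrArg (Int.cast (R := ℝ)) h
  · refine ((((hz j).pow 2).sub ((hz i).pow 2)).pow 2).congr fun n => ?_
    rw [div_pow, div_pow, Real.sq_sqrt (by positivity), ← sub_div]

theorem passWeight_eq_zero {p n k : ℕ} (hk : k ≤ 2 * n) {z : Fin p → ℤ} (hz : ¬ StrictMono z) :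
    passWeight p n k z = 0 := by
  have hempty : IsEmpty (StarTo p k fun i => (k : ℤ) + 2 * z i) := ⟨fun w => hz fun i j hij => by
    have : (k : ℤ) + 2 * z i < k + 2 * z j := w.strictMono hij
    omega⟩
  rw [passWeight, card_melon_at hk (fun i => (k : ℤ) + 2 * z i), Nat.card_of_isEmpty]
  simp

theorem eventually_passWeight_eq {p : ℕ} (hp : 1 ≤ p) {k : ℕ → ℕ} {t : ℝ} (ht0 : 0 < t)
    (ht1 : t < 1) (hk : ∀ n, k n ≤ 2 * n)
    (hkt : Tendsto (fun n => (k n : ℝ) / (2 * n)) atTop (nhds t)) (B : ℝ) :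
    ∀ᶠ n : ℕ in atTop, ∀ z : Fin p → ℤ, (∀ i, 0 ≤ (k n : ℝ) + 2 * z i ∧
      (k n : ℝ) + 2 * z i ≤ B * √(2 * n)) → StrictMono z →
        passWeight p n (k n) z = passFormula p n (k n) z := by
  filter_upwards [eventually_mul_sqrt_le ht0 hkt B, eventually_ge_atTop p,
      eventually_mul_sqrt_le (sub_pos.mpr ht1) (tendsto_ratio_compl hk hkt) B]
    with n h1 hn h2 z hz hm
  push_cast [hk n] at h2
  refine passWeight_eq_passFormula hp hn (hk n) (fun i => ?_) (fun i => ?_) (fun i => ?_) hm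
  · exact_mod_cast (hz i).1
  · exact_mod_cast (hz i).2.trans h1
  · exact_mod_cast (hz i).2.trans h2

theorem exists_abs_passFormula_le {p : ℕ} {k : ℕ → ℕ} {t : ℝ} (ht0 : 0 < t) (ht1 : t < 1)
    (hk : ∀ n, k n ≤ 2 * n) (hkt : Tendsto (fun n => (k n : ℝ) / (2 * n)) atTop (nhds t)) (B : ℝ) :
    ∃ C, ∀ᶠ n : ℕ in atTop, ∀ z : Fin p → ℤ, (∀ i, 0 ≤ (k n : ℝ) + 2 * z i ∧
      (k n : ℝ) + 2 * z i ≤ B * √(2 * n)) → |passFormula p n (k n) z| ≤ C := by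
  obtain ⟨C1, hC1⟩ := exists_choose_mul_sqrt_le ht0 tendsto_two_mul_natCast_atTop
    (tendsto_add_ratio p hkt)
  obtain ⟨C2, hC2⟩ := exists_choose_mul_sqrt_le (sub_pos.mpr ht1) tendsto_two_mul_natCast_atTop
    (tendsto_add_ratio p (tendsto_ratio_compl hk hkt))
  have hC3 := (tendsto_passConst ht0 ht1 hk hkt).abs.eventually_le_const
    (lt_add_one |passConstLimit p t|)
  refine ⟨(∏ _i : Fin p, C1 * C2 * (B + 1) ^ 2) *
    (∏ i : Fin p, ∏ _j ∈ Finset.Ioi i, ((B + 1) ^ 2) ^ 2) * (|passConstLimit p t| + 1), ?_⟩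
  filter_upwards [hC1, hC2, hC3, eventually_gt_atTop 0] with n h1 h2 h3 hn z hz
  have hm : (1 : ℝ) ≤ 2 * n := by
    have : (1 : ℝ) ≤ n := by exact_mod_cast hn
    linarith
  have hs : 1 ≤ √(2 * (n : ℝ)) := Real.one_le_sqrt.mpr hm
  have hx : ∀ i, 0 ≤ ((k n : ℝ) + 2 * z i + 1) / √(2 * n) ∧
      ((k n : ℝ) + 2 * z i + 1) / √(2 * n) ≤ B + 1 := fun i => by
    have := (hz i).1
    refine ⟨by positivity, ?_⟩
    rw [div_le_iff₀ (by positivity)]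
    linarith [(hz i).2]
  have hx2 : ∀ i, (((k n : ℝ) + 2 * z i + 1) / √(2 * n)) ^ 2 ≤ (B + 1) ^ 2 := fun i =>
    pow_le_pow_left₀ (hx i).1 (hx i).2 2
  have h1' : ∀ c, 0 ≤ scaledChoose (2 * n) (k n + 2 * p - 1) c ∧
      scaledChoose (2 * n) (k n + 2 * p - 1) c ≤ C1 := fun c =>
    ⟨by unfold scaledChoose; positivity, h1 c⟩
  have h2' : ∀ c, 0 ≤ scaledChoose (2 * n) (2 * n - k n + 2 * p - 1) c ∧
      scaledChoose (2 * n) (2 * n - k n + 2 * p - 1) c ≤ C2 := fun c =>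
    ⟨by unfold scaledChoose; positivity, h2 c⟩
  have hC1' := (h1' 0).1.trans (h1' 0).2
  have hC2' := (h2' 0).1.trans (h2' 0).2
  rw [passFormula, abs_mul, abs_mul, Finset.abs_prod, Finset.abs_prod]
  simp only [Finset.abs_prod]
  refine mul_le_mul (mul_le_mul (Finset.prod_le_prod (fun i _ => abs_nonneg _) fun i _ => ?_)
    (Finset.prod_le_prod (fun i _ => Finset.prod_nonneg fun j _ => abs_nonneg _) fun i _ =>
      Finset.prod_le_prod (fun j _ => abs_nonneg _) fun j _ => ?_)
    (Finset.prod_nonneg fun i _ => Finset.prod_nonneg fun j _ => abs_nonneg _)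
    (Finset.prod_nonneg fun i _ => by positivity)) h3 (abs_nonneg _) (mul_nonneg
      (Finset.prod_nonneg fun i _ => by positivity)
      (Finset.prod_nonneg fun i _ => Finset.prod_nonneg fun j _ => by positivity))
  · rw [abs_of_nonneg (mul_nonneg (mul_nonneg (h1' _).1 (h2' _).1) (sq_nonneg _))]
    exact mul_le_mul (mul_le_mul (h1' _).2 (h2' _).2 (h2' _).1 hC1')
      (hx2 i) (sq_nonneg _) (mul_nonneg hC1' hC2')
  · rw [abs_pow]
    gcongr
    have e : (((k n : ℝ) + 2 * z j + 1) ^ 2 - (k n + 2 * z i + 1) ^ 2) / (2 * n) =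
        (((k n : ℝ) + 2 * z j + 1) / √(2 * n)) ^ 2 -
          (((k n : ℝ) + 2 * z i + 1) / √(2 * n)) ^ 2 := by
      rw [div_pow, div_pow, Real.sq_sqrt (by positivity), ← sub_div]
    rw [e, abs_le]
    have := hx2 i
    have := hx2 j
    constructor <;> nlinarith [sq_nonneg (((k n : ℝ) + 2 * z j + 1) / √(2 * n)),
      sq_nonneg (((k n : ℝ) + 2 * z i + 1) / √(2 * n))]

theorem cellIndex_bounds {p : ℕ} (r : ℝ) (k : ℕ) (y : Fin p → ℝ) (i : Fin p) :
    (k : ℝ) + 2 * cellIndex r k y i ≤ y i * r ∧ y i * r < k + 2 * cellIndex r k y i + 2 := by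
  have h1 := Int.floor_le ((y i * r - k) / 2)
  have h2 := Int.lt_floor_add_one ((y i * r - k) / 2)
  simp only [cellIndex]
  constructor <;> linarith

theorem tendsto_cellIndex {p : ℕ} (k : ℕ → ℕ) (y : Fin p → ℝ) (i : Fin p) :
    Tendsto (fun n : ℕ => ((k n : ℝ) + 2 * cellIndex √(2 * n) (k n) y i + 1) / √(2 * n)) atTop
      (nhds (y i)) := by
  rw [tendsto_iff_norm_sub_tendsto_zero]
  refine squeeze_zero' (Eventually.of_forall fun n => norm_nonneg _) ?_ (tendsto_const_div_sqrt 1)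
  filter_upwards [eventually_gt_atTop 0] with n hn
  have hs : 0 < √(2 * (n : ℝ)) := by positivity
  have h := cellIndex_bounds √(2 * (n : ℝ)) (k n) y i
  rw [Real.norm_eq_abs, div_sub' hs.ne', abs_div, abs_of_pos hs]
  gcongr
  rw [abs_le]
  constructor <;> linarith

open Classical in
/-- The step function whose integral is the probability of the box. -/
noncomputable def stepDensity (p n k : ℕ) (u v y : Fin p → ℝ) : ℝ :=
  if cellIndex √(2 * n) k y ∈ latticeBox k (fun i => u i * √(2 * n)) (fun i => v i * √(2 * n)) then
    passWeight p n k (cellIndex √(2 * n) k y) else 0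

theorem measurable_stepDensity (p n k : ℕ) (u v : Fin p → ℝ) :
    Measurable (stepDensity p n k u v) := by
  classical
  exact (Measurable.of_discrete (f := fun z : Fin p → ℤ =>
    if z ∈ latticeBox k (fun i => u i * √(2 * n)) (fun i => v i * √(2 * n)) then
      passWeight p n k z else 0)).comp (measurable_cellIndex √(2 * (n : ℝ)) k)

theorem probW_eq_integral {p n k : ℕ} (hn : 0 < n) (hk : k ≤ 2 * n) (u v : Fin p → ℝ) :
    probW p n (fun w => ∀ i, u i * √(2 * n) ≤ (w i k : ℝ) ∧ (w i k : ℝ) ≤ v i * √(2 * n)) =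
      ∫ y, stepDensity p n k u v y :=
  (probW_eq_sum hn hk _ _).trans (integral_cellIndex (by positivity) k _ _).symm

theorem exists_abs_stepDensity_le {p : ℕ} (hp : 1 ≤ p) {k : ℕ → ℕ} {t : ℝ} (ht0 : 0 < t)
    (ht1 : t < 1) (hk : ∀ n, k n ≤ 2 * n)
    (hkt : Tendsto (fun n => (k n : ℝ) / (2 * n)) atTop (nhds t)) {u v : Fin p → ℝ}
    (hu : ∀ i, 0 < u i) (huv : ∀ i, u i < v i) :
    ∃ B C, ∀ᶠ n : ℕ in atTop, ∀ y, ‖stepDensity p n (k n) u v y‖ ≤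
      (Set.univ.pi fun _ : Fin p => Set.Icc 0 B).indicator (fun _ => C) y := by
  have hv : ∀ i, v i ≤ ∑ j, v j := fun i =>
    Finset.single_le_sum (fun j _ => ((hu j).trans (huv j)).le) (Finset.mem_univ i)
  obtain ⟨C, hC⟩ := exists_abs_passFormula_le (p := p) ht0 ht1 hk hkt (∑ j, v j)
  refine ⟨∑ j, v j + 2, max C 0, ?_⟩
  filter_upwards [hC, eventually_passWeight_eq hp ht0 ht1 hk hkt (∑ j, v j),
    eventually_gt_atTop 0] with n h1 h2 hn y
  have hm : (1 : ℝ) ≤ 2 * n := by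
    have : (1 : ℝ) ≤ n := by exact_mod_cast hn
    linarith
  have hs : 1 ≤ √(2 * (n : ℝ)) := Real.one_le_sqrt.mpr hm
  rw [stepDensity]
  split_ifs with hmem
  · rw [mem_latticeBox] at hmem
    have hz : ∀ i, 0 ≤ (k n : ℝ) + 2 * cellIndex √(2 * n) (k n) y i ∧
        (k n : ℝ) + 2 * cellIndex √(2 * n) (k n) y i ≤ (∑ j, v j) * √(2 * n) := fun i =>
      ⟨(mul_nonneg (hu i).le (by positivity)).trans (hmem i).1,
        (hmem i).2.trans (by gcongr; exact hv i)⟩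
    have hy : y ∈ Set.univ.pi fun _ : Fin p => Set.Icc 0 (∑ j, v j + 2) := fun i _ => by
      have hc := cellIndex_bounds √(2 * (n : ℝ)) (k n) y i
      have := hz i
      constructor
      · exact nonneg_of_mul_nonneg_left ((hz i).1.trans hc.1) (by positivity)
      · refine le_of_mul_le_mul_right (?_ : _ ≤ _ * √(2 * (n : ℝ))) (by positivity)
        linarith [hc.2]
    rw [Set.indicator_of_mem hy, Real.norm_eq_abs]
    by_cases hm : StrictMono (cellIndex √(2 * (n : ℝ)) (k n) y)
    · rw [h2 _ hz hm]
      exact (h1 _ hz).trans (le_max_left _ _)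
    · rw [passWeight_eq_zero (hk n) hm, abs_zero]
      exact le_max_right _ _
  · rw [norm_zero]
    exact Set.indicator_nonneg (fun _ _ => le_max_right _ _) y

theorem eventually_stepDensity_eq_zero {p : ℕ} (k : ℕ → ℕ) {u v y : Fin p → ℝ}
    (hy : y ∉ Set.univ.pi fun i => Set.Icc (u i) (v i)) :
    ∀ᶠ n : ℕ in atTop, stepDensity p n (k n) u v y = 0 := by
  simp only [Set.mem_pi, Set.mem_univ, forall_true_left, Set.mem_Icc, not_forall] at hy
  obtain ⟨i, hi⟩ := hy
  have hz := tendsto_cellIndex k y i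
  rw [not_and_or, not_le, not_le] at hi
  rcases hi with hi | hi
  · filter_upwards [eventually_gt_atTop 0] with n hn
    refine if_neg fun h => ?_
    have hs : 0 < √(2 * (n : ℝ)) := by positivity
    have h1 := (mem_latticeBox.mp h i).1.trans (cellIndex_bounds √(2 * (n : ℝ)) (k n) y i).1
    exact hi.not_ge (le_of_mul_le_mul_right h1 hs)
  · have h0 := tendsto_const_div_sqrt 1
    have hlim := (tendsto_const_nhds (x := v i)).add h0
    rw [add_zero] at hlim
    filter_upwards [hlim.eventually_lt hz hi, eventually_gt_atTop 0] with n h1 hn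
    refine if_neg fun h => ?_
    have hs : 0 < √(2 * (n : ℝ)) := by positivity
    have h2 := (mem_latticeBox.mp h i).2
    rw [lt_div_iff₀ hs, add_mul, div_mul_cancel₀ _ hs.ne'] at h1
    linarith

theorem eventually_mem_latticeBox {p : ℕ} (k : ℕ → ℕ) {u v y : Fin p → ℝ}
    (hy : y ∈ Set.univ.pi fun i => Set.Ioo (u i) (v i)) :
    ∀ᶠ n : ℕ in atTop, cellIndex √(2 * n) (k n) y ∈
      latticeBox (k n) (fun i => u i * √(2 * n)) (fun i => v i * √(2 * n)) := by
  simp only [mem_latticeBox, eventually_all]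
  intro i
  have hi := hy i (Set.mem_univ i)
  have hlim := (tendsto_const_nhds (x := u i)).add (tendsto_const_div_sqrt 1)
  rw [add_zero] at hlim
  filter_upwards [hlim.eventually_lt (tendsto_cellIndex k y i) hi.1,
    eventually_gt_atTop 0] with n h1 hn
  have hs : 0 < √(2 * (n : ℝ)) := by positivity
  rw [lt_div_iff₀ hs, add_mul, div_mul_cancel₀ _ hs.ne'] at h1
  refine ⟨by linarith, (cellIndex_bounds √(2 * (n : ℝ)) (k n) y i).1.trans ?_⟩
  have := hi.2
  gcongr

theorem eventually_cellIndex_lt {p : ℕ} (k : ℕ → ℕ) {y : Fin p → ℝ} {i j : Fin p}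
    (h : y i < y j) :
    ∀ᶠ n : ℕ in atTop, cellIndex √(2 * n) (k n) y i < cellIndex √(2 * n) (k n) y j := by
  filter_upwards [(tendsto_cellIndex k y i).eventually_lt (tendsto_cellIndex k y j) h,
    eventually_gt_atTop 0] with n h1 hn
  have hs : 0 < √(2 * (n : ℝ)) := by positivity
  rw [div_lt_div_iff_of_pos_right hs] at h1
  have : (cellIndex √(2 * n) (k n) y i : ℝ) < cellIndex √(2 * n) (k n) y j := by linarith
  exact_mod_cast this

theorem tendsto_stepDensity {p : ℕ} (hp : 1 ≤ p) {k : ℕ → ℕ} {t : ℝ} (ht0 : 0 < t)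
    (ht1 : t < 1) (hk : ∀ n, k n ≤ 2 * n)
    (hkt : Tendsto (fun n => (k n : ℝ) / (2 * n)) atTop (nhds t)) {u v y : Fin p → ℝ}
    (hu : ∀ i, 0 < u i) (hy : y ∈ Set.univ.pi fun i => Set.Ioo (u i) (v i)) :
    Tendsto (fun n => stepDensity p n (k n) u v y) atTop (nhds (fW p t y)) := by
  have hpos : ∀ i, 0 < y i := fun i => (hu i).trans (hy i (Set.mem_univ i)).1
  have hbox := eventually_mem_latticeBox k hy
  have hv : ∀ i, v i ≤ ∑ j, v j := fun i => Finset.single_le_sum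
    (fun j _ => ((hpos j).trans (hy j (Set.mem_univ j)).2).le) (Finset.mem_univ i)
  have hformula : ∀ᶠ n : ℕ in atTop, StrictMono (cellIndex √(2 * n) (k n) y) →
      stepDensity p n (k n) u v y = passFormula p n (k n) (cellIndex √(2 * n) (k n) y) := by
    filter_upwards [hbox, eventually_passWeight_eq hp ht0 ht1 hk hkt (∑ j, v j)] with n h1 h2 hm
    rw [stepDensity, if_pos h1]
    rw [mem_latticeBox] at h1
    exact h2 _ (fun i => ⟨(mul_nonneg (hu i).le (by positivity)).trans (h1 i).1,
      (h1 i).2.trans (by gcongr; exact hv i)⟩) hm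
  have hzero : ∀ n : ℕ, ¬ StrictMono (cellIndex √(2 * n) (k n) y) →
      stepDensity p n (k n) u v y = 0 := fun n hm => by
    rw [stepDensity, passWeight_eq_zero (hk n) hm, ite_self]
  have hlim := tendsto_passFormula ht0 ht1 hk hkt hpos (tendsto_cellIndex k y)
  by_cases hm : StrictMono y
  · rw [fW, if_pos ⟨fun i => (hpos i).le, fun i j hij => hm.monotone hij⟩,
      ← limitDensity_eq ht0 ht1]
    refine hlim.congr' ?_
    have hmono : ∀ᶠ n : ℕ in atTop, StrictMono (cellIndex √(2 * n) (k n) y) := by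
      have : ∀ᶠ n : ℕ in atTop, ∀ i j, i < j →
          cellIndex √(2 * n) (k n) y i < cellIndex √(2 * n) (k n) y j := by
        simp only [eventually_all]
        exact fun i j hij => eventually_cellIndex_lt k (hm hij)
      exact this.mono fun n h i j hij => h i j hij
    filter_upwards [hmono, hformula] with n h1 h2
    exact (h2 h1).symm
  · simp only [StrictMono, not_forall, not_lt] at hm
    obtain ⟨i, j, hij, hle⟩ := hm
    rcases hle.lt_or_eq with hlt | heq
    · rw [fW, if_neg fun h => hlt.not_ge (h.2 i j hij.le)]
      refine tendsto_const_nhds.congr' ?_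
      filter_upwards [eventually_cellIndex_lt k hlt] with n hn
      exact (hzero n fun h => hn.not_gt (h hij)).symm
    · have hQ := limitDensity_eq_zero (t := t) hij heq.symm
      have hf : fW p t y = 0 := by
        rw [fW, ← limitDensity_eq ht0 ht1, hQ, ite_self]
      rw [hQ] at hlim
      rw [hf]
      have hnorm := hlim.norm
      rw [norm_zero] at hnorm
      refine squeeze_zero_norm' ?_ hnorm
      filter_upwards [hformula] with n hn
      by_cases hm : StrictMono (cellIndex √(2 * (n : ℝ)) (k n) y)
      · rw [hn hm]
      · rw [hzero n hm, norm_zero]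
        positivity

/-- convergence of the rescaled one-dimensional marginals of the
uniform `(p,2n)`-watermelon with wall condition to `f(t;·)`. -/
theorem melonW_marginal_box_tendsto (p : ℕ) (hp : 1 ≤ p) (t : ℝ)
    (ht0 : 0 < t) (ht1 : t < 1) (u v : Fin p → ℝ)
    (hu : ∀ i, 0 < u i) (huv : ∀ i, u i < v i) :
    Tendsto (fun n : ℕ =>
        probW p n (fun w => ∀ i,
          u i * Real.sqrt (2 * n) ≤ (w i ⌊2 * (n : ℝ) * t⌋₊ : ℝ) ∧
          (w i ⌊2 * (n : ℝ) * t⌋₊ : ℝ) ≤ v i * Real.sqrt (2 * n)))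
      atTop
      (nhds (∫ x in Set.univ.pi fun i => Set.Icc (u i) (v i), fW p t x)) := by
  set k : ℕ → ℕ := fun n => ⌊2 * (n : ℝ) * t⌋₊ with hkdef
  have hk : ∀ n, k n ≤ 2 * n := fun n => by
    refine Nat.floor_le_of_le ?_
    push_cast
    exact mul_le_of_le_one_right (by positivity) ht1.le
  have hkt : Tendsto (fun n => (k n : ℝ) / (2 * n)) atTop (nhds t) := by
    refine ((tendsto_nat_floor_mul_div_atTop ht0.le).comp tendsto_two_mul_natCast_atTop).congr
      fun n => ?_
    rw [Function.comp_apply, mul_comm t]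
  have hmeas : MeasurableSet (Set.univ.pi fun i => Set.Icc (u i) (v i)) :=
    MeasurableSet.univ_pi fun i => measurableSet_Icc
  rw [← integral_indicator hmeas]
  obtain ⟨B, C, hbound⟩ := exists_abs_stepDensity_le hp ht0 ht1 hk hkt hu huv
  have hae : ∀ᵐ y : Fin p → ℝ, Tendsto (fun n => stepDensity p n (k n) u v y) atTop
      (nhds ((Set.univ.pi fun i => Set.Icc (u i) (v i)).indicator (fW p t) y)) := by
    have h := Measure.univ_pi_Ioo_ae_eq_Icc (μ := fun _ : Fin p => (volume : Measure ℝ))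
      (f := u) (g := v)
    rw [← Set.pi_univ_Icc] at h
    filter_upwards [h.mem_iff] with y hy
    by_cases hyI : y ∈ Set.univ.pi fun i => Set.Icc (u i) (v i)
    · rw [Set.indicator_of_mem hyI]
      exact tendsto_stepDensity hp ht0 ht1 hk hkt hu (hy.mpr hyI)
    · rw [Set.indicator_of_notMem hyI]
      exact tendsto_const_nhds.congr'
        ((eventually_stepDensity_eq_zero k hyI).mono fun n h => h.symm)
  have hint : Integrable ((Set.univ.pi fun _ : Fin p => Set.Icc 0 B).indicator fun _ => C) := by
    refine (integrable_indicator_iff (MeasurableSet.univ_pi fun i => measurableSet_Icc)).mpr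
      (integrableOn_const ?_)
    exact (isCompact_univ_pi fun i => isCompact_Icc).measure_ne_top
  refine (tendsto_integral_filter_of_dominated_convergence _
    (Eventually.of_forall fun n => (measurable_stepDensity p n (k n) u v).aestronglyMeasurable)
    (hbound.mono fun n h => ae_of_all _ h) hint hae).congr' ?_
  filter_upwards [eventually_gt_atTop 0] with n hn
  exact (probW_eq_integral hn (hk n) u v).symm
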